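/- For each n = 1,…,m and for some subsequence of {w^n_k}, it holds that w̃^n_{j,k}(x) = w^n_k(x_{j,k}) + μ^n_k c^n_j U(x) + o(μ^n_k) locally uniformly in x ∈ ℝ² for each j = 1,…,m, where U(x) = log(1/(1 + |x|²/8)²). -/

import Mathlib

open MeasureTheory Real Filter Topology Metric Bornology
open scoped RealInnerProductSpace

noncomputable section

/-- The plane `ℝ²`. -/
abbrev E2 : Type := EuclideanSpace ℝ (Fin 2)

/-- The Laplacian of a function on the plane, as the sum of the second partial
derivatives in the coordinate directions. -/
def lap (f : E2 → ℝ) (x : E2) : ℝ :=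
  ∑ i : Fin 2,
    fderiv ℝ (fun y => fderiv ℝ f y (EuclideanSpace.single i 1)) x (EuclideanSpace.single i 1)

/-- `G` is the Dirichlet Green function of `-Δ` on `Ω`, with regular part `K`
(so that `x ↦ K x x` is the Robin function). -/
structure IsGreen (Ω : Set E2) (G K : E2 → E2 → ℝ) : Prop where
  symm : ∀ x y, G x y = G y x
  decomp : ∀ x ∈ Ω, ∀ y ∈ Ω, x ≠ y →
    G x y = -(1 / (2 * π)) * Real.log (dist x y) + K x y
  harmK : ∀ y ∈ Ω, ∀ x ∈ Ω, lap (fun z => K z y) x = 0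
  harmG : ∀ y ∈ Ω, ∀ x ∈ Ω, x ≠ y → lap (fun z => G z y) x = 0
  bdry : ∀ y ∈ Ω, ∀ x ∈ frontier Ω, G x y = 0
  contK : ContinuousOn (fun p : E2 × E2 => K p.1 p.2) (closure Ω ×ˢ Ω ∪ Ω ×ˢ closure Ω)

/-- The Hamiltonian `H^m_V` of the system of `m`-point vortices:
`H^m_V(x₁,…,x_m) = ½ Σᵢ R(xᵢ) + Σ_{i<j} G(xᵢ,xⱼ) + (1/8π) Σᵢ log V(xᵢ)`. -/
def Ham (m : ℕ) (G K : E2 → E2 → ℝ) (V : E2 → ℝ) (x : Fin m → E2) : ℝ :=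
  (1 / 2) * ∑ i, K (x i) (x i)
    + ∑ i, ∑ j, (if i < j then G (x i) (x j) else 0)
    + (1 / (8 * π)) * ∑ i, Real.log (V (x i))

/-- The standard bubble `U(x) = log (1/(1+|x|²/8)²)`. -/
def U (x : E2) : ℝ := Real.log (1 / (1 + ‖x‖ ^ 2 / 8) ^ 2)

/-- `Λ` lists the eigenvalues (with multiplicity, in nondecreasing order) of the real
symmetric matrix `M`, as witnessed by an orthonormal eigenbasis. -/
def IsEigList {N : ℕ} (M : Matrix (Fin N) (Fin N) ℝ) (Λ : Fin N → ℝ) : Prop :=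
  Monotone Λ ∧ ∃ b : Fin N → (Fin N → ℝ),
    (∀ i i', (∑ t, b i t * b i' t) = if i = i' then 1 else 0) ∧
    ∀ i, M.mulVec (b i) = Λ i • b i

/-- The standing setting: a family `v_k` of solutions of the Liouville–Gel'fand problem
`-Δv = λ_k V e^v` in `Ω`, `v = 0` on `∂Ω`, blowing up at the `m` interior points
`x*₁, …, x*_m`, with local maximum points `x_{j,k} → x*_j`. -/
structure Setting (m : ℕ) where
  /-- the bounded planar domain -/
  Ω : Set E2
  /-- the positive coefficient `V ∈ C¹(Ω̄)` -/
  V : E2 → ℝ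
  /-- the parameters `λ_k ↓ 0` -/
  lam : ℕ → ℝ
  /-- the blow-up solutions -/
  v : ℕ → E2 → ℝ
  /-- the Dirichlet Green function of `-Δ` on `Ω` -/
  G : E2 → E2 → ℝ
  /-- its regular part; `x ↦ K x x` is the Robin function -/
  K : E2 → E2 → ℝ
  /-- the blow-up points -/
  xstar : Fin m → E2
  /-- the local maximum points `x_{j,k}` -/
  xpt : Fin m → ℕ → E2
  /-- the fixed small radius -/
  R : ℝ
  hm : 0 < m
  hopen : IsOpen Ω
  hbd : IsBounded Ω
  hconn : IsConnected Ω
  hVpos : ∀ x ∈ closure Ω, 0 < V x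
  hVreg : ContDiffOn ℝ 1 V (closure Ω)
  hgreen : IsGreen Ω G K
  hlam_pos : ∀ k, 0 < lam k
  hlam_anti : StrictAnti lam
  hlam0 : Tendsto lam atTop (𝓝 0)
  hv_reg : ∀ k, ContDiffOn ℝ 2 (v k) Ω
  hv_cont : ∀ k, ContinuousOn (v k) (closure Ω)
  hPDE : ∀ k, ∀ x ∈ Ω, -lap (v k) x = lam k * V x * Real.exp (v k x)
  hBC : ∀ k, ∀ x ∈ frontier Ω, v k x = 0
  hblow : Tendsto (fun k => ⨆ x ∈ closure Ω, |v k x|) atTop atTop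
  hmass : Tendsto (fun k => ∫ x in Ω, lam k * V x * Real.exp (v k x)) atTop (𝓝 (8 * π * m))
  hx_mem : ∀ j, xstar j ∈ Ω
  hx_inj : Function.Injective xstar
  hS : {x ∈ closure Ω | ∃ z : ℕ → E2, (∀ k, z k ∈ Ω) ∧ Tendsto z atTop (𝓝 x) ∧
      Tendsto (fun k => v k (z k)) atTop atTop} = Set.range xstar
  hR : 0 < R
  hR2 : ∀ j, closedBall (xstar j) (2 * R) ⊆ Ω
  hRdisj : ∀ i j, i ≠ j → Disjoint (ball (xstar i) R) (ball (xstar j) R)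
  hxpt_lim : ∀ j, Tendsto (fun k => xpt j k) atTop (𝓝 (xstar j))
  hxpt_mem : ∀ j k, xpt j k ∈ ball (xstar j) R
  hxpt_max : ∀ j k, ∀ x ∈ ball (xpt j k) R, v k x ≤ v k (xpt j k)
  hxpt_blow : ∀ j, Tendsto (fun k => v k (xpt j k)) atTop atTop

namespace Setting

variable {m : ℕ}

/-- The scaling parameter `δ_{j,k} > 0`, defined by
`λ_k V(x_{j,k}) e^{v_k(x_{j,k})} δ_{j,k}² = 1`. -/
def delta (S : Setting m) (j : Fin m) (k : ℕ) : ℝ :=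
  (Real.sqrt (S.lam k * S.V (S.xpt j k) * Real.exp (S.v k (S.xpt j k))))⁻¹

/-- The local mass `σ_{j,k} = ∫_{B_R(x_{j,k})} λ_k V e^{v_k}`. -/
def sigmaLoc (S : Setting m) (j : Fin m) (k : ℕ) : ℝ :=
  ∫ x in ball (S.xpt j k) S.R, S.lam k * S.V x * Real.exp (S.v k x)

/-- The entries of the matrix `(h_{ij})`:
`h_{ii} = R(x*_i) + 2 Σ_{h ≠ i} G(x*_h, x*_i) + (1/4π) log V(x*_i)`,
`h_{ij} = -G(x*_i, x*_j)` for `i ≠ j`. -/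
def hEnt (S : Setting m) (i j : Fin m) : ℝ :=
  if i = j then
    S.K (S.xstar i) (S.xstar i)
      + 2 * ∑ h, (if h = i then 0 else S.G (S.xstar h) (S.xstar i))
      + 1 / (4 * π) * Real.log (S.V (S.xstar i))
  else -S.G (S.xstar i) (S.xstar j)

/-- The matrix `(h_{ij})`. -/
def hmat (S : Setting m) : Matrix (Fin m) (Fin m) ℝ := Matrix.of S.hEnt

end Setting

/-- The eigenpairs `(μⁿ_k, wⁿ_k)` of the linearized problem
`-Δw = μ λ_k V e^{v_k} w` in `Ω`, `w = 0` on `∂Ω`, indexed by `n = 1, 2, …`,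
normalized by `‖wⁿ_k‖_∞ = max wⁿ_k = 1`, ordered, and orthogonal in `H¹₀`. -/
structure EigenData {m : ℕ} (S : Setting m) where
  /-- the `n`-th eigenvalue `μⁿ_k` (`n ≥ 1`) -/
  mu : ℕ → ℕ → ℝ
  /-- the `n`-th eigenfunction `wⁿ_k` -/
  w : ℕ → ℕ → E2 → ℝ
  hw_reg : ∀ n k, ContDiffOn ℝ 2 (w n k) S.Ω
  hw_cont : ∀ n k, ContinuousOn (w n k) (closure S.Ω)
  hPDE : ∀ n k, ∀ x ∈ S.Ω,
    -lap (w n k) x = mu n k * S.lam k * S.V x * Real.exp (S.v k x) * w n k x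
  hBC : ∀ n k, ∀ x ∈ frontier S.Ω, w n k x = 0
  hbound : ∀ n k, ∀ x ∈ closure S.Ω, |w n k x| ≤ 1
  hmax : ∀ n k, ∃ x ∈ closure S.Ω, w n k x = 1
  hpos : ∀ k, 0 < mu 1 k
  hlt : ∀ k, mu 1 k < mu 2 k
  hmono : ∀ k n, 2 ≤ n → mu n k ≤ mu (n + 1) k
  hdiv : ∀ k, Tendsto (fun n => mu n k) atTop atTop
  horth : ∀ k n n', 1 ≤ n → 1 ≤ n' → n ≠ n' →
    (∫ x in S.Ω, ⟪gradient (w n k) x, gradient (w n' k) x⟫) = 0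

/-- `c = (c₁,…,c_m) ≠ 0` is the limit vector of the rescaled `n`-th eigenfunctions
`w̃ⁿ_{j,k}(x) = wⁿ_k(δ_{j,k} x + x_{j,k}) → c_j` locally uniformly in `ℝ²`,
along the subsequence `φ`. -/
def IsLimitVec {m : ℕ} (S : Setting m) (W : EigenData S) (φ : ℕ → ℕ) (n : ℕ)
    (c : Fin m → ℝ) : Prop :=
  c ≠ 0 ∧ ∀ j : Fin m,
    TendstoLocallyUniformly
      (fun k (x : E2) => W.w n (φ k) (S.delta j (φ k) • x + S.xpt j (φ k)))
      (fun _ => c j) atTop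

/-- A sequence of (eigen)functions `w_k` concentrates at `κ`: there are `C > 0`
and `κ_k → κ` in `Ω` with `|w_k(κ_k)| ≥ C` for `k ≫ 1`. -/
def ConcentratesAt {m : ℕ} (S : Setting m) (wk : ℕ → E2 → ℝ) (κ : E2) : Prop :=
  ∃ C > 0, ∃ z : ℕ → E2, (∀ k, z k ∈ S.Ω) ∧ Tendsto z atTop (𝓝 κ) ∧
    ∀ᶠ k in atTop, C ≤ |wk k (z k)|

/-- The index `j` of the coordinate pair to which the `i`-th coordinate of
`ℝ^{2m} ≃ (ℝ²)^m` belongs. -/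
def coordIdx {m : ℕ} (i : Fin (2 * m)) : Fin m := ⟨i.1 / 2, by have h := i.isLt; omega⟩

/-- The `i`-th coordinate direction of `(ℝ²)^m ≃ ℝ^{2m}`. -/
def coordBasis (m : ℕ) (i : Fin (2 * m)) : Fin m → E2 :=
  Pi.single (coordIdx i) (EuclideanSpace.single ⟨i.1 % 2, by omega⟩ 1)

/-- The Hessian of the Hamiltonian `H^m_V` at `x0`, as a `2m × 2m` array of second
directional derivatives. -/
def hessHam (m : ℕ) (G K : E2 → E2 → ℝ) (V : E2 → ℝ) (x0 : Fin m → E2)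
    (i j : Fin (2 * m)) : ℝ :=
  fderiv ℝ (fun x => fderiv ℝ (Ham m G K V) x (coordBasis m j)) x0 (coordBasis m i)

/-- identification of the plane with `ℂ` -/
def cz : E2 ≃ₗᵢ[ℝ] ℂ := Complex.orthonormalBasisOneI.repr.symm

lemma cz_apply (x : E2) : cz x = (x 0 : ℂ) + (x 1 : ℂ) * Complex.I :=
  Complex.orthonormalBasisOneI_repr_symm_apply x

/-- coordinate vectors -/
abbrev ee (i : Fin 2) : E2 := EuclideanSpace.single i 1

lemma cz_e0 : cz (ee 0) = 1 := by simp [cz_apply, ee]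
lemma cz_e1 : cz (ee 1) = Complex.I := by simp [cz_apply, ee]

/-- Cauchy kernel -/
def kc (y : E2) : ℂ := (cz y)⁻¹

lemma norm_kc (y : E2) : ‖kc y‖ = ‖y‖⁻¹ := by simp [kc]

lemma measurable_kc : Measurable kc := (cz.continuous.measurable).inv

/-- d-bar operator (times two) -/
def db (h : E2 → ℂ) (x : E2) : ℂ := fderiv ℝ h x (ee 0) + Complex.I * fderiv ℝ h x (ee 1)

/-- the constant `2π` as an integral -/
def kap : ℝ := ∫ s : E2, 2 / (‖s‖ ^ 2 + 1) ^ 2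

lemma integrable_kap : Integrable (fun s : E2 => 2 / (‖s‖ ^ 2 + 1) ^ 2) := by
  have h := (integrable_rpow_neg_one_add_norm_sq (E := E2) (μ := volume) (r := 4)
    (by simp; norm_num)).const_mul 2
  refine h.congr (Eventually.of_forall fun s => ?_)
  have hp : (0 : ℝ) < 1 + ‖s‖ ^ 2 := by positivity
  have : (1 + ‖s‖ ^ 2) ^ (-(4 : ℝ) / 2) = ((1 + ‖s‖ ^ 2) ^ 2)⁻¹ := by
    rw [show (-(4 : ℝ) / 2) = -((2 : ℕ) : ℝ) by norm_num, Real.rpow_neg hp.le, Real.rpow_natCast]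
  simp only [this]
  rw [div_eq_mul_inv, add_comm]

lemma kap_pos : 0 < kap := by
  refine (integral_pos_iff_support_of_nonneg (fun s => by positivity) integrable_kap).2 ?_
  have : Function.support (fun s : E2 => 2 / (‖s‖ ^ 2 + 1) ^ 2) = Set.univ := by
    ext s
    simp only [Function.mem_support, Set.mem_univ, iff_true]
    positivity
  rw [this]; simp

/-- regularised kernel -/
def ke (ε : ℝ) (y : E2) : ℂ := (starRingEnd ℂ) (cz y) * (((‖y‖ ^ 2 + ε ^ 2 : ℝ) : ℂ))⁻¹

lemma normsq_hasFDerivAt (y : E2) : HasFDerivAt (fun y : E2 => ‖y‖ ^ 2) (2 • innerSL ℝ y) y := by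
  simpa using (hasStrictFDerivAt_norm_sq y).hasFDerivAt

lemma inner_ee (y : E2) (i : Fin 2) : inner ℝ y (ee i) = y i := by
  simp [ee, EuclideanSpace.inner_single_right]

lemma normsq_eq (y : E2) : ‖y‖ ^ 2 = y 0 ^ 2 + y 1 ^ 2 := by
  simp [EuclideanSpace.norm_sq_eq, Fin.sum_univ_two]

lemma ke_hasFDerivAt {ε : ℝ} (hε : 0 < ε) (y : E2) : DifferentiableAt ℝ (ke ε) y ∧
    ∀ v, fderiv ℝ (ke ε) y v = (starRingEnd ℂ) (cz v) * (((‖y‖ ^ 2 + ε ^ 2 : ℝ) : ℂ))⁻¹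
      - (starRingEnd ℂ) (cz y) * ((2 * inner ℝ y v : ℝ) : ℂ) * (((‖y‖ ^ 2 + ε ^ 2 : ℝ) : ℂ) ^ 2)⁻¹ := by
  have hN : (0 : ℝ) < ‖y‖ ^ 2 + ε ^ 2 := by positivity
  have h1 : HasFDerivAt (fun y : E2 => (starRingEnd ℂ) (cz y))
      ((Complex.conjCLE : ℂ →L[ℝ] ℂ).comp (cz : E2 →L[ℝ] ℂ)) y :=
    ((Complex.conjCLE : ℂ →L[ℝ] ℂ).comp (cz : E2 →L[ℝ] ℂ)).hasFDerivAt
  have h2 : HasFDerivAt (fun y : E2 => (‖y‖ ^ 2 + ε ^ 2)⁻¹)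
      (-((‖y‖ ^ 2 + ε ^ 2) ^ 2)⁻¹ • (2 • innerSL ℝ y)) y := by
    have := ((normsq_hasFDerivAt y).add_const (ε ^ 2))
    exact (hasDerivAt_inv hN.ne').comp_hasFDerivAt y this
  have h3 : HasFDerivAt (fun y : E2 => (((‖y‖ ^ 2 + ε ^ 2)⁻¹ : ℝ) : ℂ))
      (Complex.ofRealCLM.comp (-((‖y‖ ^ 2 + ε ^ 2) ^ 2)⁻¹ • (2 • innerSL ℝ y))) y :=
    Complex.ofRealCLM.hasFDerivAt.comp y h2
  have h4 := h1.mul h3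
  have h5 : ke ε = fun y : E2 => (starRingEnd ℂ) (cz y) * (((‖y‖ ^ 2 + ε ^ 2)⁻¹ : ℝ) : ℂ) := by
    funext y; simp [ke]
  have h6 := h4
  rw [show ((fun y : E2 => (starRingEnd ℂ) (cz y)) * fun y : E2 => (((‖y‖ ^ 2 + ε ^ 2)⁻¹ : ℝ) : ℂ))
    = ke ε from h5.symm] at h6
  refine ⟨h6.differentiableAt, fun v => ?_⟩
  rw [h6.fderiv]
  simp
  ring

lemma db_ke {ε : ℝ} (hε : 0 < ε) (y : E2) :
    db (ke ε) y = ((2 * ε ^ 2 / (‖y‖ ^ 2 + ε ^ 2) ^ 2 : ℝ) : ℂ) := by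
  have hN : (0 : ℝ) < ‖y‖ ^ 2 + ε ^ 2 := by positivity
  have hN' : ((‖y‖ ^ 2 + ε ^ 2 : ℝ) : ℂ) ≠ 0 := by exact_mod_cast hN.ne'
  unfold db
  rw [(ke_hasFDerivAt hε y).2, (ke_hasFDerivAt hε y).2, cz_e0, cz_e1, inner_ee, inner_ee, cz_apply]
  have : ((‖y‖ ^ 2 + ε ^ 2 : ℝ) : ℂ) = y 0 ^ 2 + y 1 ^ 2 + ε ^ 2 := by
    rw [normsq_eq]; push_cast; ring
  push_cast at this hN' ⊢
  rw [this] at hN' ⊢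
  simp only [map_add, map_mul, Complex.conj_ofReal, Complex.conj_I, map_one]
  field_simp
  ring_nf
  simp only [Complex.I_sq]
  ring_nf
  

lemma continuous_ke {ε : ℝ} (hε : 0 < ε) : Continuous (ke ε) :=
  (show Differentiable ℝ (ke ε) from fun y => (ke_hasFDerivAt hε y).1).continuous

lemma continuous_db {h : E2 → ℂ} (hh : ContDiff ℝ 1 h) : Continuous (db h) := by
  have := hh.continuous_fderiv one_ne_zero
  unfold db
  fun_prop

lemma hcs_fderiv_apply {F : Type*} [NormedAddCommGroup F] [NormedSpace ℝ F] {h : E2 → F}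
    (hc : HasCompactSupport h) (v : E2) : HasCompactSupport (fun x => fderiv ℝ h x v) :=
  hc.fderiv_apply (𝕜 := ℝ) v

lemma hcs_db {h : E2 → ℂ} (hc : HasCompactSupport h) : HasCompactSupport (db h) := by
  unfold db
  exact (hcs_fderiv_apply hc _).add ((hcs_fderiv_apply hc _).mul_left)

lemma ibp_c {f h : E2 → ℂ} (hf : ContDiff ℝ 1 f) (hh : ContDiff ℝ 1 h)
    (hc : HasCompactSupport h) (v : E2) :
    ∫ x, f x * fderiv ℝ h x v = - ∫ x, fderiv ℝ f x v * h x := by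
  have c1 := hf.continuous
  have c2 := hh.continuous
  have c3 := hf.continuous_fderiv one_ne_zero
  have c4 := hh.continuous_fderiv one_ne_zero
  apply integral_mul_fderiv_eq_neg_fderiv_mul_of_integrable
  · exact Continuous.integrable_of_hasCompactSupport (by fun_prop) hc.mul_left
  · exact Continuous.integrable_of_hasCompactSupport (by fun_prop) (hcs_fderiv_apply hc v).mul_left
  · exact Continuous.integrable_of_hasCompactSupport (by fun_prop) hc.mul_left
  · exact fun x _ => hf.differentiable one_ne_zero x
  · exact fun x _ => hh.differentiable one_ne_zero x

lemma contDiff_ke {ε : ℝ} (hε : 0 < ε) : ContDiff ℝ 1 (ke ε) := by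
  unfold ke
  have h1 : ContDiff ℝ 1 (fun y : E2 => (starRingEnd ℂ) (cz y)) :=
    ((Complex.conjCLE : ℂ →L[ℝ] ℂ).comp (cz : E2 →L[ℝ] ℂ)).contDiff
  have h2 : ContDiff ℝ 1 (fun y : E2 => (((‖y‖ ^ 2 + ε ^ 2 : ℝ) : ℂ))) :=
    Complex.ofRealCLM.contDiff.comp ((contDiff_norm_sq ℝ).add contDiff_const)
  refine h1.mul (h2.inv fun y => ?_)
  have hN : (0 : ℝ) < ‖y‖ ^ 2 + ε ^ 2 := by positivity
  exact_mod_cast hN.ne'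

lemma ibp_ke {ε : ℝ} (hε : 0 < ε) {h : E2 → ℂ} (hh : ContDiff ℝ 1 h)
    (hc : HasCompactSupport h) :
    ∫ x, ke ε x * db h x = - ∫ x, ((2 * ε ^ 2 / (‖x‖ ^ 2 + ε ^ 2) ^ 2 : ℝ) : ℂ) * h x := by
  have c1 := (contDiff_ke hε).continuous
  have c2 := hh.continuous
  have c3 := (contDiff_ke hε).continuous_fderiv one_ne_zero
  have c4 := hh.continuous_fderiv one_ne_zero
  have i1 : ∀ v, Integrable (fun x => ke ε x * fderiv ℝ h x v) := fun v =>
    Continuous.integrable_of_hasCompactSupport (by fun_prop) (hcs_fderiv_apply hc v).mul_left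
  have i2 : ∀ v, Integrable (fun x => fderiv ℝ (ke ε) x v * h x) := fun v =>
    Continuous.integrable_of_hasCompactSupport (by fun_prop) hc.mul_left
  have e1 : ∀ x, ke ε x * db h x = ke ε x * fderiv ℝ h x (ee 0)
      + Complex.I * (ke ε x * fderiv ℝ h x (ee 1)) := fun x => by unfold db; ring
  have e2 : ∀ x, ((2 * ε ^ 2 / (‖x‖ ^ 2 + ε ^ 2) ^ 2 : ℝ) : ℂ) * h x
      = fderiv ℝ (ke ε) x (ee 0) * h x + Complex.I * (fderiv ℝ (ke ε) x (ee 1) * h x) := fun x => by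
    rw [← db_ke hε]; unfold db; ring
  simp_rw [e1, e2]
  rw [integral_add (i1 _) ((i1 _).const_mul _), integral_add (i2 _) ((i2 _).const_mul _),
    integral_const_mul, integral_const_mul, ibp_c (contDiff_ke hε) hh hc, ibp_c (contDiff_ke hε) hh hc]
  ring

lemma kc_int_ball (r : ℝ) : IntegrableOn (fun y : E2 => ‖y‖⁻¹) (ball 0 r) := by
  have h := integrable_fun_norm_addHaar (E := E2) (μ := volume)
    (f := Set.indicator (Set.Iio r) (fun t : ℝ => t⁻¹))
  rw [← integrable_indicator_iff measurableSet_ball]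
  have e : (ball (0 : E2) r).indicator (fun y : E2 => ‖y‖⁻¹)
      = fun y : E2 => Set.indicator (Set.Iio r) (fun t : ℝ => t⁻¹) ‖y‖ := by
    funext y
    simp [Set.indicator]
  rw [e, h]
  have : IntegrableOn (Set.indicator (Set.Iio r) (fun _ : ℝ => (1 : ℝ))) (Set.Ioi 0) := by
    rw [integrableOn_indicator_iff measurableSet_Iio]
    refine integrableOn_const ?_
    rw [Set.inter_comm, Set.Ioi_inter_Iio]; simp
  refine this.congr_fun (fun t ht => ?_) measurableSet_Ioi
  have ht' : t ≠ 0 := ne_of_gt ht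
  simp [Set.indicator]
  split_ifs <;> simp [ht']

lemma kc_mul_integrable {f : E2 → ℂ} (hf : Continuous f) (hc : HasCompactSupport f) :
    Integrable (fun y => ‖y‖⁻¹ * ‖f y‖) := by
  obtain ⟨r, hr⟩ := hc.isCompact.isBounded.subset_ball (0 : E2)
  obtain ⟨C, hC⟩ := hf.bounded_above_of_compact_support hc
  have h1 : Integrable ((ball (0:E2) r).indicator (fun y : E2 => ‖y‖⁻¹ * C)) := by
    rw [integrable_indicator_iff measurableSet_ball]
    exact (kc_int_ball r).mul_const C
  refine h1.mono' ?_ (Eventually.of_forall fun y => ?_)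
  · exact ((measurable_norm.inv).mul hf.norm.measurable).aestronglyMeasurable
  · by_cases hy : y ∈ ball (0 : E2) r
    · rw [Set.indicator_of_mem hy, norm_mul, norm_norm, norm_inv, norm_norm]
      gcongr; exact hC y
    · have : f y = 0 := image_eq_zero_of_notMem_tsupport fun h => hy (hr h)
      rw [Set.indicator_of_notMem hy, this]; simp

/-- Cauchy–Pompeiu at the origin -/
theorem pompeiu {h : E2 → ℂ} (hh : ContDiff ℝ 1 h) (hc : HasCompactSupport h) :
    (kap : ℂ) * h 0 = - ∫ x, kc x * db h x := by
  have hε : ∀ n : ℕ, (0 : ℝ) < 1 / ((n : ℝ) + 1) := fun n => by positivity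
  have hε0 : Tendsto (fun n : ℕ => 1 / ((n : ℝ) + 1)) atTop (𝓝 0) :=
    tendsto_one_div_add_atTop_nhds_zero_nat
  have l1 : Tendsto (fun n : ℕ => ∫ x, ke (1 / ((n : ℝ) + 1)) x * db h x) atTop
      (𝓝 (∫ x, kc x * db h x)) := by
    refine tendsto_integral_of_dominated_convergence (fun y => ‖y‖⁻¹ * ‖db h y‖) ?_
      (kc_mul_integrable (continuous_db hh) (hcs_db hc)) ?_ ?_
    · exact fun n => ((continuous_ke (hε n)).mul (continuous_db hh)).aestronglyMeasurable
    · refine fun n => Eventually.of_forall fun y => ?_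
      rw [norm_mul]
      gcongr
      unfold ke
      rw [norm_mul, RCLike.norm_conj, LinearIsometryEquiv.norm_map, norm_inv, Complex.norm_real]
      rcases eq_or_ne y 0 with rfl | hy
      · simp
      have hy' : 0 < ‖y‖ := norm_pos_iff.2 hy
      have hN : (0 : ℝ) < ‖y‖ ^ 2 + (1 / ((n : ℝ) + 1)) ^ 2 := by positivity
      rw [Real.norm_of_nonneg hN.le, ← div_eq_mul_inv, div_le_iff₀ hN]
      have : ‖y‖⁻¹ * ‖y‖ ^ 2 = ‖y‖ := by field_simp
      rw [mul_add, this]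
      have : 0 ≤ ‖y‖⁻¹ * (1 / ((n : ℝ) + 1)) ^ 2 := by positivity
      linarith
    · have : ∀ᵐ y : E2, y ≠ 0 := by simp [ae_iff]
      filter_upwards [this] with y hy
      refine Tendsto.mul_const _ ?_
      have hy' : 0 < ‖y‖ := norm_pos_iff.2 hy
      have h1 : Tendsto (fun n : ℕ => (‖y‖ ^ 2 + (1 / ((n : ℝ) + 1)) ^ 2)⁻¹) atTop
          (𝓝 ((‖y‖ ^ 2 + 0 ^ 2)⁻¹)) :=
        ((hε0.pow 2).const_add _).inv₀ (by positivity)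
      have h2 : Tendsto (fun n : ℕ => ke (1 / ((n : ℝ) + 1)) y) atTop
          (𝓝 ((starRingEnd ℂ) (cz y) * (((‖y‖ ^ 2 + 0 ^ 2)⁻¹ : ℝ) : ℂ))) := by
        unfold ke
        simp_rw [← Complex.ofReal_inv]
        exact ((Complex.continuous_ofReal.tendsto _).comp h1).const_mul _
      convert h2 using 2
      unfold kc
      rw [Complex.inv_def, Complex.normSq_eq_norm_sq, LinearIsometryEquiv.norm_map]
      simp
  have l2 : Tendsto (fun n : ℕ => ∫ x, ((2 * (1 / ((n : ℝ) + 1)) ^ 2 /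
      (‖x‖ ^ 2 + (1 / ((n : ℝ) + 1)) ^ 2) ^ 2 : ℝ) : ℂ) * h x) atTop (𝓝 ((kap : ℂ) * h 0)) := by
    have e : ∀ n : ℕ, (∫ x, ((2 * (1 / ((n : ℝ) + 1)) ^ 2 /
      (‖x‖ ^ 2 + (1 / ((n : ℝ) + 1)) ^ 2) ^ 2 : ℝ) : ℂ) * h x)
        = ∫ s : E2, ((2 / (‖s‖ ^ 2 + 1) ^ 2 : ℝ) : ℂ) * h ((1 / ((n : ℝ) + 1)) • s) := by
      intro n
      generalize hq : (1 / ((n : ℝ) + 1)) = q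
      have hq0 : 0 < q := hq ▸ hε n
      have := Measure.integral_comp_smul_of_nonneg (μ := (volume : Measure E2)) (fun x : E2 =>
        ((2 * q ^ 2 / (‖x‖ ^ 2 + q ^ 2) ^ 2 : ℝ) : ℂ) * h x) q (hR := hq0.le)
      simp only [finrank_euclideanSpace, Fintype.card_fin] at this
      rw [eq_inv_smul_iff₀ (by positivity)] at this
      rw [← this, ← integral_smul]
      congr 1; funext s
      rw [norm_smul, Real.norm_of_nonneg hq0.le, Complex.real_smul, ← mul_assoc, ← Complex.ofReal_mul]
      congr 2
      have : (0:ℝ) < ‖s‖ ^ 2 + 1 := by positivity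
      rw [show (q * ‖s‖) ^ 2 + q ^ 2 = q ^ 2 * (‖s‖ ^ 2 + 1) by ring]
      field_simp
    simp_rw [e]
    have e0 : (kap : ℂ) * h 0 = ∫ s : E2, ((2 / (‖s‖ ^ 2 + 1) ^ 2 : ℝ) : ℂ) * h 0 := by
      rw [integral_mul_const, integral_complex_ofReal]; rfl
    rw [e0]
    obtain ⟨C, hC⟩ := hh.continuous.bounded_above_of_compact_support hc
    refine tendsto_integral_of_dominated_convergence (fun s => (2 / (‖s‖ ^ 2 + 1) ^ 2) * C) ?_
      (integrable_kap.mul_const C) ?_ ?_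
    · intro n
      have c := hh.continuous
      refine AEStronglyMeasurable.mul ?_ (by fun_prop)
      exact (Complex.measurable_ofReal.comp (by fun_prop)).aestronglyMeasurable
    · refine fun n => Eventually.of_forall fun s => ?_
      rw [norm_mul, Complex.norm_real, Real.norm_of_nonneg (by positivity)]
      gcongr; exact hC _
    · refine Eventually.of_forall fun s => Tendsto.const_mul _ ?_
      have := (hh.continuous.tendsto 0)
      refine this.comp ?_
      simpa using hε0.smul_const s
  have l3 := tendsto_nhds_unique (l1.congr fun n => ibp_ke (hε n) hh hc) l2.neg
  rw [l3, neg_neg]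

/-- complex gradient -/
def Dc (u : E2 → ℝ) (x : E2) : ℂ :=
  (fderiv ℝ u x (ee 0) : ℂ) - Complex.I * (fderiv ℝ u x (ee 1) : ℂ)

/-- from the complex gradient to the derivative -/
def Lm : ℂ →L[ℝ] (E2 →L[ℝ] ℝ) :=
  ((ContinuousLinearMap.compL ℝ E2 ℂ ℝ Complex.reCLM).comp
    ((ContinuousLinearMap.compL ℝ E2 ℂ ℂ).flip (cz : E2 →L[ℝ] ℂ))).comp (ContinuousLinearMap.mul ℝ ℂ)

lemma Lm_apply (P : ℂ) (h : E2) : Lm P h = (P * cz h).re := by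
  simp [Lm]

lemma Lm_norm_le (P : ℂ) : ‖Lm P‖ ≤ ‖P‖ := by
  refine ContinuousLinearMap.opNorm_le_bound _ (norm_nonneg _) fun h => ?_
  rw [Lm_apply, Real.norm_eq_abs]
  refine (Complex.abs_re_le_norm _).trans ?_
  rw [norm_mul, LinearIsometryEquiv.norm_map]

lemma e2_decomp (h : E2) : h = h 0 • ee 0 + h 1 • ee 1 := by
  ext i; fin_cases i <;> simp [ee]

lemma Lm_Dc (u : E2 → ℝ) (x : E2) : Lm (Dc u x) = fderiv ℝ u x := by
  ext h
  rw [Lm_apply]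
  conv_rhs => rw [e2_decomp h, map_add, map_smul, map_smul]
  rw [cz_apply, Dc]
  simp
  ring

lemma Dc_Lm (P : ℂ) : ((Lm P (ee 0) : ℝ) : ℂ) - Complex.I * ((Lm P (ee 1) : ℝ) : ℂ) = P := by
  rw [Lm_apply, Lm_apply, cz_e0, cz_e1]
  apply Complex.ext <;> simp

lemma contDiff_pd {u : E2 → ℝ} (hu : ContDiff ℝ 2 u) (v : E2) :
    ContDiff ℝ 1 (fun x => fderiv ℝ u x v) :=
  (hu.fderiv_right (m := 1) (by norm_num)).clm_apply contDiff_const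

lemma contDiff_Dc {u : E2 → ℝ} (hu : ContDiff ℝ 2 u) : ContDiff ℝ 1 (Dc u) := by
  unfold Dc
  exact (Complex.ofRealCLM.contDiff.comp (contDiff_pd hu _)).sub
    (contDiff_const.mul (Complex.ofRealCLM.contDiff.comp (contDiff_pd hu _)))

lemma db_Dc {u : E2 → ℝ} (hu : ContDiff ℝ 2 u) (x : E2) : db (Dc u) x = (lap u x : ℂ) := by
  have hd : ∀ w : E2, HasFDerivAt (fun x => ((fderiv ℝ u x w : ℝ) : ℂ))
      (Complex.ofRealCLM.comp (fderiv ℝ (fun x => fderiv ℝ u x w) x)) x := fun w =>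
    Complex.ofRealCLM.hasFDerivAt.comp x
      ((contDiff_pd hu w).differentiable one_ne_zero x).hasFDerivAt
  have hD : HasFDerivAt (Dc u) (Complex.ofRealCLM.comp (fderiv ℝ (fun x => fderiv ℝ u x (ee 0)) x)
      - Complex.I • (Complex.ofRealCLM.comp (fderiv ℝ (fun x => fderiv ℝ u x (ee 1)) x))) x :=
    (hd _).sub ((hd _).const_mul _)
  have hdd : DifferentiableAt ℝ (fderiv ℝ u) x :=
    (hu.fderiv_right (m := 1) (by norm_num)).differentiable one_ne_zero x
  have e : ∀ v w : E2, fderiv ℝ (fun x => fderiv ℝ u x w) x v = fderiv ℝ (fderiv ℝ u) x v w := by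
    intro v w
    rw [fderiv_clm_apply hdd (differentiableAt_const w)]
    simp
  have hs : fderiv ℝ (fderiv ℝ u) x (ee 0) (ee 1) = fderiv ℝ (fderiv ℝ u) x (ee 1) (ee 0) :=
    (hu.contDiffAt (x := x)).isSymmSndFDerivAt (by simp) _ _
  unfold db lap
  rw [hD.fderiv, Fin.sum_univ_two]
  simp only [_root_.sub_apply, _root_.smul_apply,
    ContinuousLinearMap.comp_apply, Complex.ofRealCLM_apply, smul_eq_mul]
  change _ = (((fderiv ℝ (fun x => fderiv ℝ u x (ee 0)) x (ee 0)
    + fderiv ℝ (fun x => fderiv ℝ u x (ee 1)) x (ee 1) : ℝ)) : ℂ)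
  rw [e, e, e, e, hs]
  push_cast
  ring_nf
  simp

/-- the fixed cutoff -/
def bump (R : ℝ) (hR : 0 < R) : ContDiffBump (0 : E2) :=
  ⟨R / 4, R / 2, by positivity, by linarith⟩

lemma db_mul_real {χ : E2 → ℝ} {h : E2 → ℂ} {x : E2} (h1 : DifferentiableAt ℝ χ x)
    (h2 : DifferentiableAt ℝ h x) :
    db (fun y => (χ y : ℂ) * h y) x = (χ x : ℂ) * db h x + db (fun y => (χ y : ℂ)) x * h x := by
  have h1' : DifferentiableAt ℝ (fun y => (χ y : ℂ)) x :=
    Complex.ofRealCLM.differentiableAt.comp x h1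
  unfold db
  rw [fderiv_fun_mul h1' h2]
  simp
  ring

lemma lap_continuous {u : E2 → ℝ} (hu : ContDiff ℝ 2 u) : Continuous (lap u) := by
  unfold lap
  refine continuous_finsetSum _ fun i _ => ?_
  have := (contDiff_pd hu (EuclideanSpace.single i 1)).continuous_fderiv one_ne_zero
  fun_prop

lemma fderiv_transl {F : Type*} [NormedAddCommGroup F] [NormedSpace ℝ F] (u : E2 → F) (x y : E2) :
    fderiv ℝ (fun y => u (x + y)) y = fderiv ℝ u (x + y) := by
  exact fderiv_comp_add_left x

theorem rep_global (R : ℝ) (hR : 0 < R) : ∃ C : ℝ, 0 ≤ C ∧ ∀ u : E2 → ℝ, ContDiff ℝ 2 u → ∀ x : E2,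
    ‖(kap : ℂ) * Dc u x + ∫ y, kc y * ((bump R hR y * lap u (x + y) : ℝ) : ℂ)‖
      ≤ C * ∫ y in closedBall x (R / 2), |u y| := by
  set χ := bump R hR with hχ
  have hχ1 : ContDiff ℝ 2 χ := χ.contDiff
  have hχc : HasCompactSupport χ := χ.hasCompactSupport
  have hχC : ContDiff ℝ 2 (fun y => (χ y : ℂ)) := Complex.ofRealCLM.contDiff.comp hχ1
  have hχCc : HasCompactSupport (fun y => (χ y : ℂ)) := hχc.comp_left (g := Complex.ofReal) (by simp)
  have hdbχ : ContDiff ℝ 1 (db (fun y => (χ y : ℂ))) := by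
    unfold db
    have h := hχC.fderiv_right (m := 1) (by norm_num)
    exact (h.clm_apply contDiff_const).add (contDiff_const.mul (h.clm_apply contDiff_const))
  have hdbχ0 : (db (fun y => (χ y : ℂ))) =ᶠ[𝓝 0] 0 := by
    have h1 : (fun y => (χ y : ℂ)) =ᶠ[𝓝 0] fun _ => 1 := by
      filter_upwards [χ.eventuallyEq_one] with y hy
      simp [hy]
    filter_upwards [h1.eventuallyEq_nhds] with y hy
    unfold db
    rw [hy.fderiv_eq]; simp
  -- the smooth kernel
  set Θ : E2 → ℂ := fun y => kc y * db (fun y => (χ y : ℂ)) y with hΘ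
  have hΘ1 : ContDiff ℝ 1 Θ := by
    rw [contDiff_iff_contDiffAt]
    intro y
    rcases eq_or_ne y 0 with rfl | hy
    · have : Θ =ᶠ[𝓝 0] fun _ => 0 := by
        filter_upwards [hdbχ0] with y hy
        simp [hΘ, hy]
      exact contDiffAt_const.congr_of_eventuallyEq this
    · refine ContDiffAt.mul ?_ hdbχ.contDiffAt
      unfold kc
      have : ContDiff ℝ 1 (fun y => cz y) := cz.contDiff
      exact this.contDiffAt.inv (by simpa using hy)
  have hΘc : HasCompactSupport Θ := (hcs_db hχCc).mul_left
  have hsupp : ∀ y, y ∉ closedBall (0:E2) (R/2) → ∀ᶠ z in 𝓝 y, (χ z : ℂ) = 0 := by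
    intro y hy
    have : IsOpen (closedBall (0:E2) (R/2))ᶜ := isClosed_closedBall.isOpen_compl
    filter_upwards [this.mem_nhds hy] with z hz
    have : χ z = 0 := χ.zero_of_le_dist (by
      have : R / 2 < dist z 0 := by simpa using hz
      exact this.le)
    simp [this]
  have hdb0 : ∀ y, y ∉ closedBall (0:E2) (R/2) → ∀ᶠ z in 𝓝 y, Θ z = 0 := by
    intro y hy
    have h1 : (fun y => (χ y : ℂ)) =ᶠ[𝓝 y] fun _ => 0 := hsupp y hy
    filter_upwards [h1.eventuallyEq_nhds] with z hz
    simp only [hΘ, db]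
    rw [hz.fderiv_eq]; simp
  set Ψ : E2 → ℂ := fun y => fderiv ℝ Θ y (ee 0) - Complex.I * fderiv ℝ Θ y (ee 1) with hΨ
  have hΨcont : Continuous Ψ := by
    have := hΘ1.continuous_fderiv one_ne_zero
    fun_prop
  have hΨc : HasCompactSupport Ψ :=
    (hcs_fderiv_apply hΘc _).sub ((hcs_fderiv_apply hΘc _).mul_left)
  have hΨ0 : ∀ y, y ∉ closedBall (0:E2) (R/2) → Ψ y = 0 := by
    intro y hy
    have h1 : Θ =ᶠ[𝓝 y] fun _ => 0 := hdb0 y hy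
    simp only [hΨ]
    rw [h1.fderiv_eq]; simp
  obtain ⟨C, hC⟩ := hΨcont.bounded_above_of_compact_support hΨc
  refine ⟨C, (norm_nonneg _).trans (hC 0), fun u hu x => ?_⟩
  set ux : E2 → ℝ := fun y => u (x + y) with hux
  have hux2 : ContDiff ℝ 2 ux := hu.comp (contDiff_const.add contDiff_id)
  have hDx : ∀ y, Dc ux y = Dc u (x + y) := fun y => by
    unfold Dc; rw [fderiv_transl]
  have hlx : ∀ y, lap ux y = lap u (x + y) := fun y => by
    have := db_Dc hux2 y
    rw [show Dc ux = fun y => Dc u (x + y) from funext hDx] at this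
    have h2 : db (fun y => Dc u (x + y)) y = db (Dc u) (x + y) := by
      unfold db; rw [fderiv_transl]
    rw [h2, db_Dc hu] at this
    exact_mod_cast this.symm
  have hD1 := contDiff_Dc hux2
  have hP := pompeiu (h := fun y => (χ y : ℂ) * Dc ux y)
    ((hχC.of_le (by norm_num)).mul hD1) hχCc.mul_right
  have hdb : ∀ y, kc y * db (fun y => (χ y : ℂ) * Dc ux y) y
      = kc y * ((χ y * lap u (x + y) : ℝ) : ℂ) + Θ y * Dc ux y := by
    intro y
    rw [db_mul_real (hχ1.differentiable (by norm_num) y) (hD1.differentiable one_ne_zero y),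
      db_Dc hux2, hlx]
    simp only [hΘ]; push_cast; ring
  have hχ0 : χ (0 : E2) = 1 := χ.one_of_mem_closedBall (mem_closedBall_self χ.rIn_pos.le)
  have hlapc : Continuous (fun y => lap u (x + y)) := (lap_continuous hu).comp (by fun_prop)
  have i1 : Integrable (fun y => kc y * ((χ y * lap u (x + y) : ℝ) : ℂ)) := by
    have h1 := kc_mul_integrable (f := fun y => ((χ y * lap u (x + y) : ℝ) : ℂ))
      (Complex.continuous_ofReal.comp (hχ1.continuous.mul hlapc))
      (hχc.mul_right.comp_left (g := Complex.ofReal) (by simp))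
    refine h1.mono' ?_ (Eventually.of_forall fun y => ?_)
    · exact (measurable_kc.mul (Complex.continuous_ofReal.comp
        (hχ1.continuous.mul hlapc)).measurable).aestronglyMeasurable
    · rw [norm_mul, norm_kc]
  have i2 : Integrable (fun y => Θ y * Dc ux y) :=
    Continuous.integrable_of_hasCompactSupport (hΘ1.continuous.mul hD1.continuous) hΘc.mul_right
  simp_rw [hdb] at hP
  rw [integral_add i1 i2, hχ0, hDx] at hP
  simp only [add_zero, Complex.ofReal_one, one_mul] at hP
  rw [hP]
  have huC : ContDiff ℝ 1 (fun y => (ux y : ℂ)) :=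
    Complex.ofRealCLM.contDiff.comp (hux2.of_le (by norm_num))
  have hfd : ∀ y v, fderiv ℝ (fun y => (ux y : ℂ)) y v = ((fderiv ℝ ux y v : ℝ) : ℂ) := by
    intro y v
    have : HasFDerivAt (fun y => (ux y : ℂ)) (Complex.ofRealCLM.comp (fderiv ℝ ux y)) y :=
      Complex.ofRealCLM.hasFDerivAt.comp y (hux2.differentiable (by norm_num) y).hasFDerivAt
    rw [this.fderiv]; simp
  have i3 : ∀ v, Integrable (fun y => fderiv ℝ (fun y => (ux y : ℂ)) y v * Θ y) := fun v => by
    have := huC.continuous_fderiv one_ne_zero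
    have := hΘ1.continuous
    exact Continuous.integrable_of_hasCompactSupport (by fun_prop) hΘc.mul_left
  have i4 : ∀ v, Integrable (fun y => (ux y : ℂ) * fderiv ℝ Θ y v) := fun v => by
    have := huC.continuous
    have := hΘ1.continuous_fderiv one_ne_zero
    exact Continuous.integrable_of_hasCompactSupport (by fun_prop) (hcs_fderiv_apply hΘc v).mul_left
  have e2 : ∫ y, Θ y * Dc ux y = - ∫ y, Ψ y * (ux y : ℂ) := by
    have a1 : ∀ y, Θ y * Dc ux y = fderiv ℝ (fun y => (ux y : ℂ)) y (ee 0) * Θ y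
        - Complex.I * (fderiv ℝ (fun y => (ux y : ℂ)) y (ee 1) * Θ y) := by
      intro y; rw [hfd, hfd]; unfold Dc; ring
    have a2 : ∀ y, Ψ y * (ux y : ℂ) = (ux y : ℂ) * fderiv ℝ Θ y (ee 0)
        - Complex.I * ((ux y : ℂ) * fderiv ℝ Θ y (ee 1)) := by
      intro y; simp only [hΨ]; ring
    simp_rw [a1, a2]
    rw [integral_sub (i3 _) ((i3 _).const_mul _), integral_sub (i4 _) ((i4 _).const_mul _),
      integral_const_mul, integral_const_mul, ibp_c huC hΘ1 hΘc, ibp_c huC hΘ1 hΘc]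
    ring
  rw [e2, neg_add_rev, neg_neg, neg_add_cancel_right]
  have e3 : ∫ y in closedBall x (R / 2), |u y| = ∫ y in closedBall (0:E2) (R/2), |ux y| := by
    rw [← integral_indicator measurableSet_closedBall, ← integral_indicator measurableSet_closedBall,
      ← integral_add_left_eq_self _ x]
    congr 1; funext y
    simp only [Set.indicator, mem_closedBall, hux]
    simp [dist_eq_norm]
  rw [e3, ← integral_const_mul, ← integral_indicator measurableSet_closedBall]
  refine norm_integral_le_of_norm_le ?_ (Eventually.of_forall fun y => ?_)
  · rw [integrable_indicator_iff measurableSet_closedBall]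
    exact (continuous_const.mul hux2.continuous.abs).continuousOn.integrableOn_compact
      (isCompact_closedBall _ _)
  · by_cases hy : y ∈ closedBall (0:E2) (R/2)
    · rw [Set.indicator_of_mem hy, norm_mul, Complex.norm_real, Real.norm_eq_abs]
      gcongr; exact hC y
    · rw [Set.indicator_of_notMem hy, hΨ0 y hy]; simp

/-- a function which is `C²` near a closed ball agrees with a global one on a smaller ball -/
lemma extend_C2 {Ω : Set E2} (hΩ : IsOpen Ω) {u : E2 → ℝ} (hu : ContDiffOn ℝ 2 u Ω) {p : E2} {r s : ℝ}
    (hr : 0 < r) (hrs : r < s) (hp : closedBall p s ⊆ Ω) :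
    ∃ g : E2 → ℝ, ContDiff ℝ 2 g ∧ ∀ x ∈ ball p r, g x = u x := by
  let χ : ContDiffBump p := ⟨r, s, hr, hrs⟩
  refine ⟨fun x => χ x * u x, ?_, fun x hx => ?_⟩
  · rw [contDiff_iff_contDiffAt]
    intro x
    by_cases hx : x ∈ closedBall p s
    · exact χ.contDiff.contDiffAt.mul ((hu x (hp hx)).contDiffAt (hΩ.mem_nhds (hp hx)))
    · have : (fun x => χ x * u x) =ᶠ[𝓝 x] fun _ => 0 := by
        filter_upwards [isClosed_closedBall.isOpen_compl.mem_nhds hx] with z hz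
        rw [χ.zero_of_le_dist (by
          have : s < dist z p := by simpa using hz
          exact this.le), zero_mul]
      exact contDiffAt_const.congr_of_eventuallyEq this
  · simp [χ.one_of_mem_closedBall (ball_subset_closedBall hx)]

lemma lap_congr {u g : E2 → ℝ} {x : E2} (h : u =ᶠ[𝓝 x] g) : lap u x = lap g x := by
  unfold lap
  refine Finset.sum_congr rfl fun i _ => ?_
  have : (fun y => fderiv ℝ u y (EuclideanSpace.single i 1))
      =ᶠ[𝓝 x] fun y => fderiv ℝ g y (EuclideanSpace.single i 1) := by
    filter_upwards [h.eventuallyEq_nhds] with y hy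
    rw [hy.fderiv_eq]
  rw [this.fderiv_eq]

lemma Dc_congr {u g : E2 → ℝ} {x : E2} (h : u =ᶠ[𝓝 x] g) : Dc u x = Dc g x := by
  unfold Dc; rw [h.fderiv_eq]

theorem rep_local (R : ℝ) (hR : 0 < R) : ∃ C : ℝ, 0 ≤ C ∧ ∀ (Ω : Set E2), IsOpen Ω →
    ∀ u : E2 → ℝ, ContDiffOn ℝ 2 u Ω → ∀ p : E2, closedBall p R ⊆ Ω → ∀ x ∈ ball p (R / 4),
    ‖(kap : ℂ) * Dc u x + ∫ y, kc y * ((bump R hR y * lap u (x + y) : ℝ) : ℂ)‖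
      ≤ C * ∫ y in ball p R, |u y| := by
  obtain ⟨C, hC0, hC⟩ := rep_global R hR
  refine ⟨C, hC0, fun Ω hΩ u hu p hp x hx => ?_⟩
  obtain ⟨g, hg, hgu⟩ := extend_C2 hΩ hu (r := 7 * R / 8) (by positivity) (by linarith) hp
  have hev : ∀ y ∈ ball p (7 * R / 8), g =ᶠ[𝓝 y] u := fun y hy => by
    filter_upwards [isOpen_ball.mem_nhds hy] with z hz using hgu z hz
  have hx' : dist x p < R / 4 := hx
  have hxm : x ∈ ball p (7 * R / 8) := by rw [mem_ball]; linarith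
  have h := hC g hg x
  rw [Dc_congr (hev x hxm)] at h
  have e : (fun y => kc y * ((bump R hR y * lap g (x + y) : ℝ) : ℂ))
      = fun y => kc y * ((bump R hR y * lap u (x + y) : ℝ) : ℂ) := by
    funext y
    by_cases hy : dist y 0 < R / 2
    · rw [lap_congr (hev (x + y) _)]
      rw [mem_ball]
      calc dist (x + y) p ≤ dist (x + y) x + dist x p := dist_triangle _ _ _
        _ < 7 * R / 8 := by
          have : dist (x + y) x = dist y 0 := by simp [dist_eq_norm]
          rw [this]; linarith
    · rw [(bump R hR).zero_of_le_dist (not_lt.1 hy)]; simp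
  rw [e] at h
  refine h.trans (mul_le_mul_of_nonneg_left ?_ hC0)
  have hsub : closedBall x (R / 2) ⊆ ball p (7 * R / 8) := by
    intro y hy
    have : dist y x ≤ R / 2 := hy
    rw [mem_ball]
    linarith [dist_triangle y x p]
  rw [setIntegral_congr_fun (g := fun y => |u y|) measurableSet_closedBall
    (fun y hy => by simp only; rw [hgu y (hsub hy)])]
  refine setIntegral_mono_set ?_ (Eventually.of_forall fun y => abs_nonneg _) ?_
  · exact ((hu.continuousOn.abs.mono hp).integrableOn_compact
      (isCompact_closedBall _ _)).mono_set ball_subset_closedBall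
  · exact (hsub.trans (ball_subset_ball (by linarith))).eventuallyLE

/-- mass of the kernel on a ball -/
def KK (r : ℝ) : ℝ := ∫ y in ball (0 : E2) r, ‖y‖⁻¹

lemma KK_nonneg (r : ℝ) : 0 ≤ KK r := integral_nonneg fun y => by positivity

/-- truncated kernel -/
def tk (r : ℝ) : E2 → ℝ := (ball (0 : E2) r).indicator (fun y => ‖y‖⁻¹)

lemma tk_int (r : ℝ) (x : E2) : Integrable (fun y => tk r (y - x)) := by
  have : Integrable (tk r) := by
    unfold tk
    rw [integrable_indicator_iff measurableSet_ball]; exact kc_int_ball r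
  exact this.comp_sub_right x

lemma tk_integral (r : ℝ) (x : E2) : ∫ y, tk r (y - x) = KK r := by
  rw [integral_sub_right_eq_self (fun y => tk r y) x]
  unfold tk KK
  rw [integral_indicator measurableSet_ball]

lemma kern_bound {F : E2 → ℂ} {B : ℝ} (hB : ∀ y, ‖F y‖ ≤ B) (x y : E2) :
    ‖kc (y - x) * F y‖ ≤ tk 1 (y - x) * B + ‖F y‖ := by
  rw [norm_mul, norm_kc]
  by_cases h : y - x ∈ ball (0 : E2) 1
  · unfold tk
    rw [Set.indicator_of_mem h]
    have := mul_le_mul_of_nonneg_left (hB y) (inv_nonneg.2 (norm_nonneg (y - x)))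
    linarith [norm_nonneg (F y)]
  · unfold tk
    rw [Set.indicator_of_notMem h]
    have h1 : 1 ≤ ‖y - x‖ := by simpa using h
    have := mul_le_mul_of_nonneg_right (inv_le_one_of_one_le₀ h1) (norm_nonneg (F y))
    linarith

lemma measurable_kc_sub (x : E2) : Measurable (fun y => kc (y - x)) :=
  measurable_kc.comp (measurable_id.sub_const x)

lemma kern_integrable {F : E2 → ℂ} (hF : Integrable F) {B : ℝ} (hB : ∀ y, ‖F y‖ ≤ B) (x : E2) :
    Integrable (fun y => kc (y - x) * F y) := by
  refine (((tk_int 1 x).mul_const B).add hF.norm).mono' ?_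
    (Eventually.of_forall fun y => kern_bound hB x y)
  exact (measurable_kc_sub x).aestronglyMeasurable.mul hF.aestronglyMeasurable

lemma kern_norm_le {F : E2 → ℂ} (hF : Integrable F) {B : ℝ} (hB : ∀ y, ‖F y‖ ≤ B) (x : E2) :
    ∫ y, ‖kc (y - x) * F y‖ ≤ KK 1 * B + ∫ y, ‖F y‖ := by
  have h := integral_mono (kern_integrable hF hB x).norm (((tk_int 1 x).mul_const B).add hF.norm)
    (fun y => kern_bound hB x y)
  refine h.trans (le_of_eq ?_)
  simp only [Pi.add_apply]
  rw [integral_add ((tk_int 1 x).mul_const B) hF.norm, integral_mul_const, tk_integral]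

lemma kern_le {F : E2 → ℂ} (hF : Integrable F) {B : ℝ} (hB : ∀ y, ‖F y‖ ≤ B) (x : E2) :
    ‖∫ y, kc (y - x) * F y‖ ≤ KK 1 * B + ∫ y, ‖F y‖ :=
  (norm_integral_le_integral_norm _).trans (kern_norm_le hF hB x)

/-- symmetrisation -/
lemma symmetrize {F : E2 → ℂ} (hF : Integrable F) (hFm : Measurable F) {B : ℝ}
    (hB : ∀ y, ‖F y‖ ≤ B) (x : E2) :
    (∫ y, kc (y - x) * F y) * (∫ y, kc (y - x) * F y)
      = 2 * ∫ y, kc (y - x) * F y * ∫ s, kc (s - y) * F s := by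
  set a : E2 → ℂ := fun y => kc (y - x) * F y with ha
  have hai : Integrable a := kern_integrable hF hB x
  set b : E2 → E2 → ℂ := fun y s => a y * (kc (s - y) * F s) with hb
  have hbm : Measurable (Function.uncurry b) := by
    have h1 : Measurable (fun p : E2 × E2 => a p.1) :=
      ((measurable_kc_sub x).mul hFm).comp measurable_fst
    have h2 : Measurable (fun p : E2 × E2 => kc (p.2 - p.1) * F p.2) :=
      (measurable_kc.comp (measurable_snd.sub measurable_fst)).mul (hFm.comp measurable_snd)
    exact h1.mul h2
  have hbi1 : ∀ y, Integrable (b y) := fun y => (kern_integrable hF hB y).const_mul _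
  have hbi : Integrable (Function.uncurry b) (volume.prod volume) := by
    rw [integrable_prod_iff hbm.aestronglyMeasurable]
    refine ⟨Eventually.of_forall hbi1, ?_⟩
    refine (hai.norm.mul_const (KK 1 * B + ∫ y, ‖F y‖)).mono' ?_ (Eventually.of_forall fun y => ?_)
    · exact hbm.norm.aestronglyMeasurable.integral_prod_right'
    · rw [Real.norm_of_nonneg (integral_nonneg fun _ => norm_nonneg _)]
      simp only [Function.uncurry, hb]
      simp_rw [norm_mul (a y)]
      rw [integral_const_mul]
      exact mul_le_mul_of_nonneg_left (kern_norm_le hF hB y) (norm_nonneg _)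
  have hae : ∀ z : E2, ∀ᵐ y : E2, y ≠ z := fun z => by simp [ae_iff]
  have key : ∀ y, y ≠ x → ∀ᵐ s, a y * a s = b y s + b s y := by
    intro y hy
    filter_upwards [hae x, hae y] with s hs hsy
    have h1 : cz y - cz x ≠ 0 := by rw [← map_sub]; simpa [sub_eq_zero] using hy
    have h2 : cz s - cz x ≠ 0 := by rw [← map_sub]; simpa [sub_eq_zero] using hs
    have h3 : cz s - cz y ≠ 0 := by rw [← map_sub]; simpa [sub_eq_zero] using hsy
    have h4 : cz y - cz s ≠ 0 := by rw [← neg_sub]; exact neg_ne_zero.2 h3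
    have h5 : cz y - cz s = -(cz s - cz y) := by ring
    simp only [ha, hb, kc, map_sub]
    rw [h5]
    field_simp
    ring
  have e1 : (∫ y, a y) * (∫ s, a s) = ∫ y, (∫ s, b y s) + ∫ s, b s y := by
    rw [← integral_mul_const]
    refine integral_congr_ae ?_
    filter_upwards [hae x] with y hy
    rw [← integral_const_mul, integral_congr_ae (key y hy)]
    have : Integrable (fun s => b s y) := by
      have h := (hai.const_mul (a y)).sub (hbi1 y)
      refine h.congr ?_
      filter_upwards [key y hy] with s hs
      simp only [Pi.sub_apply]
      rw [hs]; ring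
    rw [integral_add (hbi1 y) this]
  have e2 : ∫ y, (∫ s, b s y) = ∫ y, ∫ s, b y s := (integral_integral_swap hbi).symm
  rw [e1, integral_add, e2, ← two_mul]
  · congr 2; funext y
    simp only [hb]; rw [integral_const_mul]
  · exact hbi.integral_prod_left
  · exact hbi.integral_prod_right

lemma Lm_inj {P : ℂ} (h : Lm P = 0) : P = 0 := by
  have := Dc_Lm P
  rw [h] at this
  simpa using this.symm

lemma P_eq_Dc {v : E2 → ℝ} {P : E2 → ℂ} (hd : ∀ x, HasFDerivAt v (Lm (P x)) x) : P = Dc v := by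
  funext x
  rw [Dc, (hd x).fderiv, Dc_Lm]

lemma P_deriv {v : E2 → ℝ} (hi : Integrable (fun y => Real.exp (v y))) (hle : ∀ x, v x ≤ 0)
    {P : E2 → ℂ} (hP : ∀ x, (kap : ℂ) * P x = ∫ y, kc (y - x) * (Real.exp (v y) : ℂ))
    (hd : ∀ x, HasFDerivAt v (Lm (P x)) x) (x : E2) :
    ∃ P' : E2 →L[ℝ] ℂ, HasFDerivAt P P' x ∧ P' (ee 0) - Complex.I * P' (ee 1) = P x ^ 2 / 2 := by
  have hk : (kap : ℂ) ≠ 0 := by exact_mod_cast kap_pos.ne'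
  have hvc : Continuous v := continuous_iff_continuousAt.2 fun x => (hd x).continuousAt
  set ρ : E2 → ℂ := fun y => (Real.exp (v y) : ℂ) with hρ
  have hρc : Continuous ρ := Complex.continuous_ofReal.comp (Real.continuous_exp.comp hvc)
  have hρi : Integrable ρ := hi.ofReal
  have hρn : ∀ y, ‖ρ y‖ = Real.exp (v y) := fun y => by
    simp only [hρ]; rw [Complex.norm_real, Real.norm_of_nonneg (Real.exp_pos _).le]
  have hρ1 : ∀ y, ‖ρ y‖ ≤ 1 := fun y => by
    rw [hρn]; exact Real.exp_le_one_iff.2 (hle y)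
  set C : ℝ := kap⁻¹ * (KK 1 * 1 + ∫ y, ‖ρ y‖) with hC
  have hPb : ∀ x, ‖P x‖ ≤ C := fun x => by
    have h1 : P x = (kap : ℂ)⁻¹ * ∫ y, kc (y - x) * ρ y := by
      rw [← hP x]; field_simp
    rw [h1, norm_mul, norm_inv, Complex.norm_real, Real.norm_of_nonneg kap_pos.le]
    exact mul_le_mul_of_nonneg_left (kern_le hρi hρ1 x) (inv_nonneg.2 kap_pos.le)
  have hC0 : 0 ≤ C := (norm_nonneg _).trans (hPb 0)
  have hlip : ∀ x y, v x - v y ≤ C * ‖x - y‖ := fun x y => by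
    refine (le_abs_self _).trans ?_
    have := convex_univ.norm_image_sub_le_of_norm_hasFDerivWithin_le (f := v) (C := C)
      (fun z _ => (hd z).hasFDerivWithinAt) (fun z _ => (Lm_norm_le _).trans (hPb z))
      (Set.mem_univ y) (Set.mem_univ x)
    simpa using this
  have hPm : Measurable P := by
    rw [P_eq_Dc hd]; unfold Dc
    have h1 := fun w => measurable_fderiv_apply_const ℝ v w
    exact (Complex.measurable_ofReal.comp (h1 _)).sub
      ((Complex.measurable_ofReal.comp (h1 _)).const_mul _)
  have hρd : ∀ x, HasFDerivAt ρ (Complex.ofRealCLM.comp (Real.exp (v x) • Lm (P x))) x := fun x =>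
    Complex.ofRealCLM.hasFDerivAt.comp x (hd x).exp
  have hconv : ∀ x, ∫ y, kc (y - x) * ρ y = ∫ y, kc y * ρ (x + y) := fun x => by
    rw [← integral_add_left_eq_self _ x]
    congr 1; funext y; simp
  set F' : E2 → E2 → E2 →L[ℝ] ℂ := fun x y =>
    kc y • (Complex.ofRealCLM.comp (Real.exp (v (x + y)) • Lm (P (x + y)))) with hF'
  have hF'm : ∀ x, AEStronglyMeasurable (F' x) := fun x => by
    refine measurable_kc.aestronglyMeasurable.smul ?_
    have h1 : AEStronglyMeasurable (fun y => Real.exp (v (x + y)) • Lm (P (x + y))) := by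
      refine AEStronglyMeasurable.smul (f := fun y => Real.exp (v (x + y))) ?_ ?_
      · exact (Continuous.aestronglyMeasurable (by fun_prop))
      · exact Lm.continuous.comp_aestronglyMeasurable
          (hPm.comp (measurable_const_add x)).aestronglyMeasurable
    exact (ContinuousLinearMap.compL ℝ E2 ℝ ℂ Complex.ofRealCLM).continuous.comp_aestronglyMeasurable h1
  have hintx : ∀ x, Integrable (fun y => kc y * ρ (x + y)) := fun x => by
    have := (kern_integrable hρi hρ1 x).comp_add_left x
    refine this.congr (Eventually.of_forall fun y => ?_)
    simp
  have hder : HasFDerivAt (fun x => ∫ y, kc y * ρ (x + y)) (∫ y, F' x y) x ∧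
      Integrable (F' x) := by
    have hbound : ∀ y, ∀ z ∈ ball x 1, ‖F' z y‖ ≤ ‖kc y * ρ (x + y)‖ * (Real.exp C * C) := by
      intro y z hz
      simp only [hF']
      rw [norm_smul, norm_mul, mul_assoc]
      refine mul_le_mul_of_nonneg_left ?_ (norm_nonneg _)
      refine (ContinuousLinearMap.opNorm_comp_le _ _).trans ?_
      rw [Complex.ofRealCLM_norm, one_mul, norm_smul, Real.norm_of_nonneg (Real.exp_pos _).le, hρn,
        ← mul_assoc, ← Real.exp_add]
      refine mul_le_mul ?_ ((Lm_norm_le _).trans (hPb _)) (norm_nonneg _) (Real.exp_pos _).le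
      refine Real.exp_le_exp.2 ?_
      have h1 := hlip (z + y) (x + y)
      have h2 : ‖z + y - (x + y)‖ ≤ 1 := by
        have : ‖z - x‖ < 1 := by rw [← dist_eq_norm]; exact hz
        simpa using this.le
      nlinarith
    refine ⟨hasFDerivAt_integral_of_dominated_of_fderiv_le (𝕜 := ℝ) (F := fun x y => kc y * ρ (x + y))
      (F' := F') (bound := fun y => ‖kc y * ρ (x + y)‖ * (Real.exp C * C)) (s := ball x 1)
      (ball_mem_nhds x one_pos) ?_ (hintx x) (hF'm x) (Eventually.of_forall hbound)
      ((hintx x).norm.mul_const _) ?_, ?_⟩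
    · exact Eventually.of_forall fun z => (hintx z).aestronglyMeasurable
    · refine Eventually.of_forall fun y z _ => ?_
      have h1 : HasFDerivAt (fun z => ρ (z + y))
          (Complex.ofRealCLM.comp (Real.exp (v (z + y)) • Lm (P (z + y)))) z :=
        hasFDerivAt_comp_add_right y |>.2 (hρd (z + y))
      exact h1.const_mul (kc y)
    · exact ((hintx x).norm.mul_const _).mono' (hF'm x)
        (Eventually.of_forall fun y => hbound y x (mem_ball_self one_pos))
  have hPe : P = fun x => (kap : ℂ)⁻¹ * ∫ y, kc y * ρ (x + y) := by
    funext x; rw [← hconv, ← hP x]; field_simp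
  refine ⟨(kap : ℂ)⁻¹ • ∫ y, F' x y, ?_, ?_⟩
  · conv => enter [1]; rw [hPe]
    exact hder.1.const_mul _
  · have h1 : ∀ w, (∫ y, F' x y) w = ∫ y, F' x y w := fun w =>
      ContinuousLinearMap.integral_apply hder.2 w
    have h2 : ∀ w, Integrable (fun y => F' x y w) := fun w =>
      (ContinuousLinearMap.apply ℝ ℂ w).integrable_comp hder.2
    have h3 : (∫ y, F' x y (ee 0)) - Complex.I * (∫ y, F' x y (ee 1))
        = ∫ y, kc (y - x) * ρ y * P y := by
      rw [← integral_const_mul, ← integral_sub (h2 _) ((h2 _).const_mul _)]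
      rw [← integral_add_left_eq_self (fun y => kc (y - x) * ρ y * P y) x]
      congr 1; funext y
      simp only [hF', hρ]
      have := Dc_Lm (P (x + y))
      simp only [_root_.smul_apply, ContinuousLinearMap.comp_apply, Complex.ofRealCLM_apply,
        smul_eq_mul, Complex.ofReal_mul, add_sub_cancel_left]
      linear_combination (kc y * (Real.exp (v (x + y)) : ℂ)) * this
    have h4 := symmetrize hρi hρc.measurable hρ1 x
    have h5 : ∫ y, kc (y - x) * ρ y * ∫ s, kc (s - y) * ρ s = kap * ∫ y, kc (y - x) * ρ y * P y := by
      rw [← integral_const_mul]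
      congr 1; funext y
      rw [← hP y]; ring
    rw [h5, ← hP x] at h4
    simp only [_root_.smul_apply, smul_eq_mul]
    rw [h1, h1]
    have h6 : (kap : ℂ)⁻¹ * (∫ y, F' x y (ee 0)) - Complex.I * ((kap : ℂ)⁻¹ * ∫ y, F' x y (ee 1))
      = (kap : ℂ)⁻¹ * ((∫ y, F' x y (ee 0)) - Complex.I * (∫ y, F' x y (ee 1))) := by ring
    rw [h6, h3]
    have h7 : (kap : ℂ) * P x ^ 2 = 2 * ∫ y, kc (y - x) * ρ y * P y := by
      apply mul_left_cancel₀ hk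
      linear_combination h4
    rw [inv_mul_eq_div, div_eq_div_iff hk two_ne_zero]
    linear_combination -h7

theorem classify {v : E2 → ℝ} (hi : Integrable (fun y => Real.exp (v y))) (hle : ∀ x, v x ≤ 0)
    (h0 : v 0 = 0)
    {P : E2 → ℂ} (hP : ∀ x, (kap : ℂ) * P x = ∫ y, kc (y - x) * (Real.exp (v y) : ℂ))
    (hd : ∀ x, HasFDerivAt v (Lm (P x)) x) :
    ∃ d : ℝ, 0 ≤ d ∧ ∀ x, Real.exp (-(1 / 2) * v x) = 1 + d * ‖x‖ ^ 2 := by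
  choose P' hP' hPe using fun x => P_deriv hi hle hP hd x
  set φ : E2 → ℝ := fun x => Real.exp (-(1 / 2) * v x) with hφ
  set Q : E2 → ℂ := fun x => (-(1 / 2) * φ x : ℝ) • P x with hQ
  have hφd : ∀ x, HasFDerivAt φ (Lm (Q x)) x := fun x => by
    have h1 := ((hd x).const_mul (-(1 / 2))).exp
    have : Lm (Q x) = Real.exp (-(1 / 2) * v x) • (-(1 / 2 : ℝ)) • Lm (P x) := by
      simp only [hQ, hφ]; rw [map_smul, smul_smul, mul_comm]
    rw [this]; exact h1
  have hQd : ∀ x, ∃ Q' : E2 →L[ℝ] ℂ, HasFDerivAt Q Q' x ∧ Q' (ee 0) = Complex.I * Q' (ee 1) := by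
    intro x
    refine ⟨_, ((hφd x).const_mul (-(1 / 2))).smul (hP' x), ?_⟩
    have e1 := hPe x
    have e2 := Dc_Lm (Q x)
    simp only [ContinuousLinearMap.add_apply, _root_.smul_apply, ContinuousLinearMap.smulRight_apply,
      smul_eq_mul, Complex.real_smul] at *
    simp only [hQ, Complex.real_smul] at *
    push_cast at *
    linear_combination (-(1 / 2) * (φ x : ℂ)) * e1 - (1 / 2) * P x * e2
  choose Q' hQ' hQe using hQd
  have hsym : ∀ x, (Q' x (ee 0) * Complex.I).re = (Q' x (ee 1)).re := fun x => by
    have h1 : HasFDerivAt (fun y => Lm (Q y)) (Lm.comp (Q' x)) x := Lm.hasFDerivAt.comp x (hQ' x)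
    have := second_derivative_symmetric hφd h1 (ee 0) (ee 1)
    simpa [Lm_apply, cz_e0, cz_e1] using this
  have q1re : ∀ x, (Q' x (ee 1)).re = 0 := fun x => by
    have h1 := hsym x
    have h2 := congrArg Complex.im (hQe x)
    simp at h1 h2
    linarith
  have q0im : ∀ x, (Q' x (ee 0)).im = 0 := fun x => by
    have h2 := congrArg Complex.im (hQe x)
    simp at h2
    rw [h2, q1re]
  have q10 : ∀ x, (Q' x (ee 1)).im = - (Q' x (ee 0)).re := fun x => by
    have h2 := congrArg Complex.re (hQe x)
    simp at h2
    linarith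
  -- lines
  have l0 : ∀ r s : ℝ, HasDerivAt (fun s : ℝ => Q (s • ee 0 + r • ee 1))
      (Q' (s • ee 0 + r • ee 1) (ee 0)) s := fun r s => by
    have h1 : HasDerivAt (fun s : ℝ => s • ee 0 + r • ee 1) (ee 0) s := by
      simpa using ((hasDerivAt_id s).smul_const (ee 0)).add_const (r • ee 1)
    exact (hQ' _).comp_hasDerivAt s h1
  have l1 : ∀ s r : ℝ, HasDerivAt (fun r : ℝ => Q (s • ee 0 + r • ee 1))
      (Q' (s • ee 0 + r • ee 1) (ee 1)) r := fun s r => by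
    have h1 : HasDerivAt (fun r : ℝ => s • ee 0 + r • ee 1) (ee 1) r := by
      simpa using ((hasDerivAt_id r).smul_const (ee 1)).const_add (s • ee 0)
    exact (hQ' _).comp_hasDerivAt r h1
  have a0 := fun r s => Complex.reCLM.hasFDerivAt.comp_hasDerivAt s (l0 r s)
  have b0 := fun r s => Complex.imCLM.hasFDerivAt.comp_hasDerivAt s (l0 r s)
  have a1 := fun s r => Complex.reCLM.hasFDerivAt.comp_hasDerivAt r (l1 s r)
  have b1 := fun s r => Complex.imCLM.hasFDerivAt.comp_hasDerivAt r (l1 s r)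
  simp only [Complex.reCLM_apply, Complex.imCLM_apply, Function.comp_def, q0im, q1re] at a0 b0 a1 b1
  have ca : ∀ s r, (Q (s • ee 0 + r • ee 1)).re = (Q (s • ee 0 + (0:ℝ) • ee 1)).re := fun s r =>
    is_const_of_deriv_eq_zero (fun r => (a1 s r).differentiableAt) (fun r => (a1 s r).deriv) r 0
  have cb : ∀ s r, (Q (s • ee 0 + r • ee 1)).im = (Q ((0:ℝ) • ee 0 + r • ee 1)).im := fun s r =>
    is_const_of_deriv_eq_zero (fun s => (b0 r s).differentiableAt) (fun s => (b0 r s).deriv) s 0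
  set t : ℝ → ℝ → ℝ := fun s r => (Q' (s • ee 0 + r • ee 1) (ee 0)).re with ht
  have t1 : ∀ s r, t s r = t s 0 := fun s r => by
    have h1 := a0 r s
    simp_rw [ca _ r] at h1
    exact h1.unique (a0 0 s)
  have t2 : ∀ s r, t s r = t 0 r := fun s r => by
    have h1 := b1 s r
    simp_rw [cb s, q10] at h1
    have h2 := h1.unique (b1 0 r)
    rw [q10] at h2
    exact neg_injective h2
  have tc : ∀ x, (Q' x (ee 0)).re = t 0 0 := fun x => by
    rw [← t2 (x 0) 0, ← t1 (x 0) (x 1), ht]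
    simp only
    rw [← e2_decomp x]
  set T := t 0 0
  have hQ'e : ∀ x h, Q' x h = (T : ℂ) * (starRingEnd ℂ) (cz h) := fun x h => by
    have e0 : Q' x (ee 0) = (T : ℂ) := by
      apply Complex.ext <;> simp [tc, q0im]
    have e1 : Q' x (ee 1) = -(T : ℂ) * Complex.I := by
      apply Complex.ext <;> simp [tc, q10, q1re]
    conv_lhs => rw [e2_decomp h, map_add, map_smul, map_smul, e0, e1]
    rw [cz_apply]
    simp
    ring
  have hQ0 : Q 0 = 0 := by
    have h1 : IsLocalMax v 0 := Eventually.of_forall fun x => by simp only [h0]; exact hle x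
    have h2 : Lm (P 0) = 0 := h1.hasFDerivAt_eq_zero (hd 0)
    simp [hQ, Lm_inj h2]
  have hQx : ∀ x, Q x = (T : ℂ) * (starRingEnd ℂ) (cz x) := by
    have hlin : ∀ x : E2, HasFDerivAt (fun x : E2 => (T : ℂ) * (starRingEnd ℂ) (cz x))
        ((T : ℂ) • ((Complex.conjCLE : ℂ →L[ℝ] ℂ).comp (cz : E2 →L[ℝ] ℂ))) x := fun x =>
      (((Complex.conjCLE : ℂ →L[ℝ] ℂ).comp (cz : E2 →L[ℝ] ℂ)).hasFDerivAt).const_mul _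
    have hz : ∀ x, HasFDerivAt (fun x => Q x - (T : ℂ) * (starRingEnd ℂ) (cz x)) (0 : E2 →L[ℝ] ℂ) x := by
      intro x
      have := (hQ' x).sub (hlin x)
      have e : Q' x - ((T : ℂ) • ((Complex.conjCLE : ℂ →L[ℝ] ℂ).comp (cz : E2 →L[ℝ] ℂ))) = 0 := by
        apply ContinuousLinearMap.ext
        intro h
        simp [hQ'e]
      rw [e] at this
      exact this
    intro x
    have := is_const_of_fderiv_eq_zero (𝕜 := ℝ) (fun x => (hz x).differentiableAt)
      (fun x => (hz x).fderiv) x 0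
    simp only [hQ0, map_zero, mul_zero, sub_zero] at this
    exact sub_eq_zero.1 this
  have hφx : ∀ x, φ x = 1 + T / 2 * ‖x‖ ^ 2 := by
    have hz : ∀ x, HasFDerivAt (fun x => φ x - T / 2 * ‖x‖ ^ 2) (0 : E2 →L[ℝ] ℝ) x := by
      intro x
      have := (hφd x).sub ((normsq_hasFDerivAt x).const_mul (T / 2))
      have e : Lm (Q x) - (T / 2) • ((2 : ℝ) • innerSL ℝ x) = 0 := by
        apply ContinuousLinearMap.ext
        intro h
        simp only [_root_.zero_apply, _root_.sub_apply, _root_.smul_apply, innerSL_apply_apply]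
        rw [Lm_apply, hQx, cz_apply, cz_apply, EuclideanSpace.inner_eq_star_dotProduct]
        simp [dotProduct, Fin.sum_univ_two]
        ring
      have e' := e
      simp only [ofNat_smul_eq_nsmul] at e'
      first
      | rw [e] at this; exact this
      | rw [e'] at this; exact this
    intro x
    have := is_const_of_fderiv_eq_zero (𝕜 := ℝ) (fun x => (hz x).differentiableAt)
      (fun x => (hz x).fderiv) x 0
    simp [hφ, h0] at this
    simp only [hφ]
    norm_num at this ⊢
    linarith
  refine ⟨T / 2, ?_, hφx⟩
  have h1 := hφx (ee 0)
  have h2 : 1 ≤ φ (ee 0) := Real.one_le_exp (by linarith [hle (ee 0)])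
  simp [ee] at h1
  simp [ee] at h2
  linarith

lemma kc_smul (δ : ℝ) (y : E2) : kc (δ • y) = (δ : ℂ)⁻¹ * kc y := by
  simp [kc, map_smul, mul_comm]

theorem rep_scaled (R : ℝ) (hR : 0 < R) : ∃ C : ℝ, 0 ≤ C ∧ ∀ (Ω : Set E2), IsOpen Ω →
    ∀ u : E2 → ℝ, ContDiffOn ℝ 2 u Ω → ∀ p : E2, closedBall p R ⊆ Ω → ∀ δ : ℝ, 0 < δ →
    ∀ F : E2 → ℝ, (∀ y, ‖δ • y‖ < R → F y = - (δ ^ 2 * lap u (p + δ • y))) →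
    ∀ x : E2, ‖δ • x‖ < R / 4 →
    ‖(kap : ℂ) * (δ * Dc u (p + δ • x))
      - ∫ y, kc (y - x) * ((bump R hR (δ • (y - x)) * F y : ℝ) : ℂ)‖
      ≤ C * δ * ∫ y in ball p R, |u y| := by
  obtain ⟨C, hC0, hC⟩ := rep_local R hR
  refine ⟨C, hC0, fun Ω hΩ u hu p hp δ hδ F hF x hx => ?_⟩
  have h := hC Ω hΩ u hu p hp (p + δ • x) (by simpa [dist_eq_norm] using hx)
  set f : E2 → ℂ := fun y => kc y * ((bump R hR y * lap u (p + δ • x + y) : ℝ) : ℂ) with hf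
  have e1 : ∫ y, f y = ((δ ^ 2 : ℝ) : ℂ) * ∫ y, f (δ • y) := by
    rw [Measure.integral_comp_smul_of_nonneg volume f δ (hR := hδ.le)]
    simp only [finrank_euclideanSpace, Fintype.card_fin, Complex.real_smul]
    rw [← mul_assoc, ← Complex.ofReal_mul, mul_inv_cancel₀ (by positivity)]
    simp
  have hδ' : (δ : ℂ) ≠ 0 := by exact_mod_cast hδ.ne'
  have e2 : ∀ y, ((δ ^ 3 : ℝ) : ℂ) * f (δ • y)
      = - (kc y * ((bump R hR (δ • y) * F (x + y) : ℝ) : ℂ)) := by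
    intro y
    simp only [hf, kc_smul]
    by_cases hy : dist (δ • y) 0 < R / 2
    · rw [hF (x + y), smul_add, add_assoc p]
      · push_cast
        field_simp
      · rw [dist_zero_right] at hy
        rw [smul_add]
        linarith [norm_add_le (δ • x) (δ • y)]
    · rw [(bump R hR).zero_of_le_dist (not_lt.1 hy)]; simp
  have e3 : ∫ y, kc (y - x) * ((bump R hR (δ • (y - x)) * F y : ℝ) : ℂ)
      = - ((δ : ℂ) * ∫ y, f y) := by
    rw [e1, ← integral_add_left_eq_self _ x]
    rw [← mul_assoc, show (δ : ℂ) * ((δ ^ 2 : ℝ) : ℂ) = ((δ ^ 3 : ℝ) : ℂ) by push_cast; ring,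
      ← integral_const_mul, ← integral_neg]
    congr 1; funext y
    rw [e2]; simp
  rw [e3]
  rw [show (kap : ℂ) * (δ * Dc u (p + δ • x)) - - ((δ : ℂ) * ∫ y, f y)
    = (δ : ℂ) * ((kap : ℂ) * Dc u (p + δ • x) + ∫ y, f y) by ring, norm_mul, Complex.norm_real,
    Real.norm_of_nonneg hδ.le]
  calc δ * _ ≤ δ * (C * ∫ y in ball p R, |u y|) := mul_le_mul_of_nonneg_left h hδ.le
    _ = _ := by ring

lemma bump_mul_integrable {R : ℝ} (hR : 0 < R) (δ : ℝ) {F : E2 → ℝ} (hF : Integrable F) (x : E2) :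
    Integrable (fun y => bump R hR (δ • (y - x)) * F y) := by
  refine hF.bdd_mul (c := 1) ?_ (Eventually.of_forall fun y => ?_)
  · have := (bump R hR).continuous
    exact (by fun_prop : Continuous fun y => bump R hR (δ • (y - x))).aestronglyMeasurable
  · rw [Real.norm_of_nonneg (bump R hR).nonneg]
    exact (bump R hR).le_one

lemma bump_mul_le {R : ℝ} (hR : 0 < R) (z : E2) (a : ℝ) : |bump R hR z * a| ≤ |a| := by
  rw [abs_mul, abs_of_nonneg (bump R hR).nonneg]
  exact mul_le_of_le_one_left (abs_nonneg _) (bump R hR).le_one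

theorem limH {l : Filter ℕ} {δ : ℕ → ℝ} (hδ : Tendsto δ l (𝓝 0)) {R : ℝ} (hR : 0 < R)
    {F : ℕ → E2 → ℝ} {F0 : E2 → ℝ} {B C : ℝ} (hi : ∀ k, Integrable (F k))
    (hB : ∀ k y, |F k y| ≤ B) (hC : ∀ k, ∫ y, |F k y| ≤ C) (hi0 : Integrable F0)
    (hB0 : ∀ y, |F0 y| ≤ B)
    (hl : ∀ M η : ℝ, 0 < η → ∀ᶠ k in l, ∀ y ∈ ball (0 : E2) M, |F k y - F0 y| ≤ η)
    (r ε : ℝ) (hr : 0 < r) (hε : 0 < ε) :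
    ∀ᶠ k in l, ∀ x ∈ ball (0 : E2) r,
      ‖(∫ y, kc (y - x) * ((bump R hR (δ k • (y - x)) * F k y : ℝ) : ℂ))
        - ∫ y, kc (y - x) * (F0 y : ℂ)‖ ≤ ε := by
  set C0 := ∫ y, |F0 y|
  have hC0 : 0 ≤ C0 := integral_nonneg fun _ => abs_nonneg _
  have hCn : 0 ≤ C := (integral_nonneg fun _ => abs_nonneg _).trans (hC 0)
  set M : ℝ := r + 1 + 2 * (C + C0) / ε with hM
  have hq : 0 ≤ 2 * (C + C0) / ε := by positivity
  have hMr : 0 < M - r := by rw [hM]; linarith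
  have hM1 : (M - r)⁻¹ * (C + C0) ≤ ε / 2 := by
    rw [inv_mul_le_iff₀ hMr, hM]
    have : (r + 1 + 2 * (C + C0) / ε - r) * (ε / 2) = ε / 2 + (C + C0) := by
      field_simp; ring
    rw [this]; linarith
  set η : ℝ := ε / (2 * (KK (M + r) + 1)) with hη
  have hK := KK_nonneg (M + r)
  have hη0 : 0 < η := by positivity
  have hη1 : KK (M + r) * η ≤ ε / 2 := by
    have : (KK (M + r) + 1) * η = ε / 2 := by rw [hη]; field_simp
    nlinarith
  have hsm : ∀ᶠ k in l, |δ k| * (M + r) < R / 4 := by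
    have : Tendsto (fun k => |δ k| * (M + r)) l (𝓝 (|0| * (M + r))) := hδ.abs.mul_const _
    rw [abs_zero, zero_mul] at this
    exact this.eventually (gt_mem_nhds (by positivity))
  filter_upwards [hl M η hη0, hsm] with k hk hks x hx
  have hx' : ‖x‖ < r := by simpa using hx
  have i1 : Integrable (fun y => kc (y - x) * ((bump R hR (δ k • (y - x)) * F k y : ℝ) : ℂ)) := by
    refine kern_integrable (F := fun y => ((bump R hR (δ k • (y - x)) * F k y : ℝ) : ℂ)) (B := B)
      (bump_mul_integrable hR _ (hi k) x).ofReal (fun y => ?_) x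
    rw [Complex.norm_real]
    exact (bump_mul_le hR _ _).trans (hB k y)
  have i2 : Integrable (fun y => kc (y - x) * (F0 y : ℂ)) :=
    kern_integrable (F := fun y => (F0 y : ℂ)) (B := B) hi0.ofReal
      (fun y => by rw [Complex.norm_real]; exact hB0 y) x
  rw [← integral_sub i1 i2]
  have hb : ∀ y, ‖kc (y - x) * ((bump R hR (δ k • (y - x)) * F k y : ℝ) : ℂ)
      - kc (y - x) * (F0 y : ℂ)‖ ≤ tk (M + r) (y - x) * η + (M - r)⁻¹ * (|F k y| + |F0 y|) := by
    intro y
    rw [← mul_sub, ← Complex.ofReal_sub, norm_mul, norm_kc, Complex.norm_real, Real.norm_eq_abs]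
    by_cases hy : y ∈ ball (0 : E2) M
    · have hy' : ‖y‖ < M := by simpa using hy
      have hyx : ‖y - x‖ < M + r := (norm_sub_le _ _).trans_lt (by linarith)
      have hone : bump R hR (δ k • (y - x)) = 1 := by
        apply (bump R hR).one_of_mem_closedBall
        rw [mem_closedBall, dist_zero_right, norm_smul, Real.norm_eq_abs]
        refine le_trans ?_ hks.le
        exact mul_le_mul_of_nonneg_left hyx.le (abs_nonneg _)
      unfold tk
      rw [hone, one_mul, Set.indicator_of_mem (by simpa using hyx)]
      have h1 := mul_le_mul_of_nonneg_left (hk y hy) (inv_nonneg.2 (norm_nonneg (y - x)))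
      have h2 : 0 ≤ (M - r)⁻¹ * (|F k y| + |F0 y|) := by positivity
      linarith
    · have hy' : M ≤ ‖y‖ := by simpa using hy
      have hyx : M - r ≤ ‖y - x‖ := by linarith [norm_sub_norm_le y x]
      have h1 : |bump R hR (δ k • (y - x)) * F k y - F0 y| ≤ |F k y| + |F0 y| :=
        (abs_sub _ _).trans (by linarith [bump_mul_le hR (δ k • (y - x)) (F k y)])
      have h2 : ‖y - x‖⁻¹ ≤ (M - r)⁻¹ := inv_anti₀ hMr hyx
      have h3 : 0 ≤ tk (M + r) (y - x) * η :=
        mul_nonneg (Set.indicator_nonneg (fun _ _ => by positivity) _) hη0.le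
      have := mul_le_mul h2 h1 (abs_nonneg _) (inv_nonneg.2 hMr.le)
      linarith
  have i3 := (tk_int (M + r) x).mul_const η
  have i4 := ((hi k).abs.add hi0.abs).const_mul (M - r)⁻¹
  have i4' : Integrable (fun y => (M - r)⁻¹ * (|F k y| + |F0 y|)) := i4
  refine (norm_integral_le_of_norm_le (i3.add i4') (Eventually.of_forall hb)).trans ?_
  simp only [Pi.add_apply]
  rw [integral_add i3 i4', integral_mul_const, tk_integral, integral_const_mul,
    integral_add (hi k).abs hi0.abs]
  have h5 : (M - r)⁻¹ * ((∫ y, |F k y|) + C0) ≤ (M - r)⁻¹ * (C + C0) :=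
    mul_le_mul_of_nonneg_left (by linarith [hC k]) (inv_nonneg.2 hMr.le)
  linarith

/-- weak form of the representation formula -/
lemma weak_db {ρ : E2 → ℂ} (hρ : Integrable ρ) (hρm : Measurable ρ) {B : ℝ} (hB : ∀ y, ‖ρ y‖ ≤ B)
    {P : E2 → ℂ} (hP : ∀ x, (kap : ℂ) * P x = ∫ y, kc (y - x) * ρ y)
    {h : E2 → ℂ} (hh : ContDiff ℝ 1 h) (hc : HasCompactSupport h) :
    ∫ x, P x * db h x = ∫ y, ρ y * h y := by
  have hk : (kap : ℂ) ≠ 0 := by exact_mod_cast kap_pos.ne'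
  have hdc := continuous_db hh
  have hdi : Integrable (db h) := hdc.integrable_of_hasCompactSupport (hcs_db hc)
  set b : E2 → E2 → ℂ := fun x y => db h x * (kc (y - x) * ρ y) with hb
  have hbm : Measurable (Function.uncurry b) := by
    have h1 : Measurable (fun p : E2 × E2 => db h p.1) := hdc.measurable.comp measurable_fst
    have h2 : Measurable (fun p : E2 × E2 => kc (p.2 - p.1) * ρ p.2) :=
      (measurable_kc.comp (measurable_snd.sub measurable_fst)).mul (hρm.comp measurable_snd)
    exact h1.mul h2
  have hbi : Integrable (Function.uncurry b) (volume.prod volume) := by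
    rw [integrable_prod_iff hbm.aestronglyMeasurable]
    refine ⟨Eventually.of_forall fun x => (kern_integrable hρ hB x).const_mul (db h x), ?_⟩
    refine (hdi.norm.mul_const (KK 1 * B + ∫ y, ‖ρ y‖)).mono' ?_ (Eventually.of_forall fun x => ?_)
    · exact hbm.norm.aestronglyMeasurable.integral_prod_right'
    · rw [Real.norm_of_nonneg (integral_nonneg fun _ => norm_nonneg _)]
      simp only [Function.uncurry, hb]
      simp_rw [norm_mul (db h x)]
      rw [integral_const_mul]
      exact mul_le_mul_of_nonneg_left (kern_norm_le hρ hB x) (norm_nonneg _)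
  have hsw := integral_integral_swap hbi
  have e1 : ∀ x, ∫ y, b x y = (kap : ℂ) * (P x * db h x) := fun x => by
    simp only [hb]; rw [integral_const_mul, ← hP]; ring
  have e2 : ∀ y, ∫ x, b x y = (kap : ℂ) * (ρ y * h y) := fun y => by
    have hy : ContDiff ℝ 1 (fun x => h (y + x)) := hh.comp (contDiff_const.add contDiff_id)
    have hcy : HasCompactSupport (fun x => h (y + x)) :=
      hc.comp_homeomorph (Homeomorph.addLeft y)
    have hpo := pompeiu hy hcy
    simp only [add_zero] at hpo
    have : (kap : ℂ) * (ρ y * h y) = ρ y * ((kap : ℂ) * h y) := by ring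
    rw [this, hpo, ← integral_neg, ← integral_const_mul, ← integral_add_left_eq_self _ y]
    congr 1; funext x
    have hd : db (fun x => h (y + x)) x = db h (y + x) := by
      unfold db
      rw [fderiv_comp_add_left]
    rw [hd]
    simp only [hb]
    have : kc (y - (y + x)) = - kc x := by simp [kc]
    rw [this]; ring
  simp_rw [e1, e2] at hsw
  rw [integral_const_mul, integral_const_mul] at hsw
  exact mul_left_cancel₀ hk hsw

theorem classify_U {v : E2 → ℝ} (hi : Integrable (fun y => Real.exp (v y))) (hle : ∀ x, v x ≤ 0)
    (h0 : v 0 = 0)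
    {P : E2 → ℂ} (hP : ∀ x, (kap : ℂ) * P x = ∫ y, kc (y - x) * (Real.exp (v y) : ℂ))
    (hd : ∀ x, HasFDerivAt v (Lm (P x)) x) : v = U := by
  obtain ⟨d, hd0, hφ⟩ := classify hi hle h0 hP hd
  have hvc : Continuous v := continuous_iff_continuousAt.2 fun x => (hd x).continuousAt
  have hpos : ∀ x : E2, 0 < 1 + d * ‖x‖ ^ 2 := fun x => by positivity
  have hexp : ∀ x, Real.exp (v x) = ((1 + d * ‖x‖ ^ 2) ^ 2)⁻¹ := fun x => by
    rw [← hφ x, ← Real.exp_nat_mul, ← Real.exp_neg]; congr 1; push_cast; ring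
  have hLm : ∀ x i, Lm (P x) (ee i) = - (4 * d * x i / (1 + d * ‖x‖ ^ 2)) := fun x i => by
    have h1 : HasFDerivAt (fun x => Real.exp (-(1/2) * v x))
        (Real.exp (-(1/2) * v x) • ((-(1/2) : ℝ) • Lm (P x))) x := ((hd x).const_mul _).exp
    have h2 : HasFDerivAt (fun x : E2 => 1 + d * ‖x‖ ^ 2) (d • (2 • innerSL ℝ x)) x :=
      ((normsq_hasFDerivAt x).const_mul d).const_add 1
    have h3 : (fun x => Real.exp (-(1/2) * v x)) = fun x : E2 => 1 + d * ‖x‖ ^ 2 := funext hφ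
    rw [h3] at h1
    have h4 := congrArg (fun L => L (ee i)) (h1.unique h2)
    simp only [_root_.smul_apply, innerSL_apply_apply, inner_ee, hφ x, smul_eq_mul, nsmul_eq_mul] at h4
    have := (hpos x).ne'
    field_simp
    push_cast at h4
    linarith
  have hPe : ∀ x, P x = - (4 * d / (1 + d * ‖x‖ ^ 2) : ℝ) * (starRingEnd ℂ) (cz x) := fun x => by
    rw [← Dc_Lm (P x), hLm, hLm, cz_apply]
    push_cast
    simp only [map_add, map_mul, Complex.conj_ofReal, Complex.conj_I]
    ring
  set h : E2 → ℂ := fun x => ((bump 1 one_pos x : ℝ) : ℂ) with hh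
  have hhd : ContDiff ℝ 1 h := Complex.ofRealCLM.contDiff.comp (bump 1 one_pos).contDiff
  have hhc : HasCompactSupport h :=
    (bump 1 one_pos).hasCompactSupport.comp_left Complex.ofReal_zero
  have hρc : Continuous (fun y => (Real.exp (v y) : ℂ)) :=
    Complex.continuous_ofReal.comp (Real.continuous_exp.comp hvc)
  have hw := weak_db (ρ := fun y => (Real.exp (v y) : ℂ)) hi.ofReal hρc.measurable (B := 1)
    (fun y => by
      rw [Complex.norm_real, Real.norm_of_nonneg (Real.exp_pos _).le]
      exact Real.exp_le_one_iff.2 (hle y)) hP hhd hhc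
  have key : ∫ x, P x * db h x = ((8 * d : ℝ) : ℂ) * ∫ y, (Real.exp (v y) : ℂ) * h y := by
    rcases hd0.eq_or_lt with hz | hdp
    · have : ∀ x, P x = 0 := fun x => by rw [hPe, ← hz]; simp
      simp [this, ← hz]
    · have hε : 0 < (Real.sqrt d)⁻¹ := by positivity
      have hε2 : (Real.sqrt d)⁻¹ ^ 2 = d⁻¹ := by rw [inv_pow, Real.sq_sqrt hd0]
      have hPk : ∀ x, P x = -4 * ke (Real.sqrt d)⁻¹ x := fun x => by
        rw [hPe, ke, hε2]
        have h1 : ((1 + d * ‖x‖ ^ 2 : ℝ) : ℂ) ≠ 0 := by exact_mod_cast (hpos x).ne'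
        have h2 : ((‖x‖ ^ 2 + d⁻¹ : ℝ) : ℂ) = (d : ℂ)⁻¹ * ((1 + d * ‖x‖ ^ 2 : ℝ) : ℂ) := by
          rw [← Complex.ofReal_inv, ← Complex.ofReal_mul]
          congr 1; field_simp; ring
        have h3 : (d : ℂ) ≠ 0 := by exact_mod_cast hdp.ne'
        rw [h2]
        push_cast at h1 ⊢
        field_simp
      simp_rw [hPk, mul_assoc (-4 : ℂ)]
      rw [integral_const_mul, ibp_ke hε hhd hhc, ← integral_neg, ← integral_const_mul,
        ← integral_const_mul]
      congr 1; funext x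
      rw [hε2, hexp]
      have : 2 * d⁻¹ / (‖x‖ ^ 2 + d⁻¹) ^ 2 = 2 * d * ((1 + d * ‖x‖ ^ 2) ^ 2)⁻¹ := by
        have h1 := (hpos x).ne'
        have h2 : ‖x‖ ^ 2 + d⁻¹ = d⁻¹ * (1 + d * ‖x‖ ^ 2) := by field_simp; ring
        rw [h2]; field_simp
      rw [this]
      push_cast; ring
  rw [hw] at key
  have hI : ∫ y, (Real.exp (v y) : ℂ) * h y = ((∫ y, Real.exp (v y) * bump 1 one_pos y : ℝ) : ℂ) := by
    rw [← integral_complex_ofReal]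
    simp [hh]
  have hIpos : 0 < ∫ y, Real.exp (v y) * bump 1 one_pos y := by
    refine Continuous.integral_pos_of_hasCompactSupport_nonneg_nonzero (x := 0) ?_ ?_ ?_ ?_
    · have := (bump 1 one_pos).continuous
      fun_prop
    · exact (bump 1 one_pos).hasCompactSupport.mul_left
    · intro y; exact mul_nonneg (Real.exp_pos _).le (bump 1 one_pos).nonneg
    · have : bump 1 one_pos 0 = 1 := (bump 1 one_pos).one_of_mem_closedBall (by
        simp [(bump 1 one_pos).rIn_pos.le])
      rw [this]; simp
  rw [hI] at key
  have key2 : (∫ y, Real.exp (v y) * bump 1 one_pos y)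
    = (8 * d) * ∫ y, Real.exp (v y) * bump 1 one_pos y := by exact_mod_cast key
  have hd8 : d = 1 / 8 := by
    have : (1 - 8 * d) * ∫ y, Real.exp (v y) * bump 1 one_pos y = 0 := by linarith
    rcases mul_eq_zero.1 this with h | h
    · linarith
    · exact absurd h hIpos.ne'
  funext x
  rw [U, ← Real.log_exp (v x), hexp, hd8, one_div]
  congr 4; ring

/-- the a-priori data of a rescaled sequence -/
structure Resc (R : ℝ) (hR : 0 < R) (δ : ℕ → ℝ) (f : ℕ → E2 → ℝ) (P : ℕ → E2 → ℂ) (F : ℕ → E2 → ℝ)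
    (A B C : ℝ) : Prop where
  f0 : ∀ k, f k 0 = 0
  hd : ∀ k x, ‖δ k • x‖ < R / 4 → HasFDerivAt (f k) (Lm (P k x)) x
  hP : ∀ k x, ‖δ k • x‖ < R / 4 →
    ‖(kap : ℂ) * P k x - ∫ y, kc (y - x) * ((bump R hR (δ k • (y - x)) * F k y : ℝ) : ℂ)‖ ≤ A * δ k
  hi : ∀ k, Integrable (F k)
  hB : ∀ k y, |F k y| ≤ B
  hC : ∀ k, ∫ y, |F k y| ≤ C

lemma small_ev {l : Filter ℕ} {δ : ℕ → ℝ} (hδ : Tendsto δ l (𝓝 0)) {R : ℝ} (hR : 0 < R) (r : ℝ) :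
    ∀ᶠ k in l, ∀ x ∈ ball (0 : E2) r, ‖δ k • x‖ < R / 4 := by
  have : Tendsto (fun k => |δ k| * |r|) l (𝓝 (|0| * |r|)) := hδ.abs.mul_const _
  rw [abs_zero, zero_mul] at this
  filter_upwards [this.eventually (gt_mem_nhds (by positivity : 0 < R / 4))] with k hk x hx
  rw [norm_smul, Real.norm_eq_abs]
  refine lt_of_le_of_lt (mul_le_mul_of_nonneg_left ?_ (abs_nonneg _)) hk
  have : ‖x‖ < r := by simpa using hx
  exact this.le.trans (le_abs_self r)

theorem grad_lim {R : ℝ} {hR : 0 < R} {δ : ℕ → ℝ} {f : ℕ → E2 → ℝ} {P : ℕ → E2 → ℂ} {F : ℕ → E2 → ℝ}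
    {A B C : ℝ} (H : Resc R hR δ f P F A B C) {l : Filter ℕ} (hδ : Tendsto δ l (𝓝 0))
    {F0 : E2 → ℝ} (hi0 : Integrable F0) (hB0 : ∀ y, |F0 y| ≤ B)
    (hl : ∀ M η : ℝ, 0 < η → ∀ᶠ k in l, ∀ y ∈ ball (0 : E2) M, |F k y - F0 y| ≤ η)
    {P0 : E2 → ℂ} (hP0 : ∀ x, (kap : ℂ) * P0 x = ∫ y, kc (y - x) * (F0 y : ℂ))
    (r ε : ℝ) (hr : 0 < r) (hε : 0 < ε) :
    ∀ᶠ k in l, ∀ x ∈ ball (0 : E2) r, ‖P k x - P0 x‖ ≤ ε := by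
  have h1 := limH hδ hR H.hi H.hB H.hC hi0 hB0 hl r (kap * ε / 2) hr
    (by have := kap_pos; positivity)
  have h2 : ∀ᶠ k in l, A * δ k < kap * ε / 2 := by
    have : Tendsto (fun k => A * δ k) l (𝓝 (A * 0)) := hδ.const_mul _
    rw [mul_zero] at this
    exact this.eventually (gt_mem_nhds (by have := kap_pos; positivity))
  filter_upwards [h1, h2, small_ev hδ hR r] with k h1 h2 h3 x hx
  have h4 := H.hP k x (h3 x hx)
  have h5 := h1 x hx
  rw [← hP0] at h5
  have h6 : ‖(kap : ℂ) * (P k x - P0 x)‖ ≤ kap * ε := by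
    rw [mul_sub]
    refine (norm_sub_le_norm_sub_add_norm_sub _
      (∫ y, kc (y - x) * ((bump R hR (δ k • (y - x)) * F k y : ℝ) : ℂ)) _).trans ?_
    linarith
  rw [norm_mul, Complex.norm_real, Real.norm_of_nonneg kap_pos.le] at h6
  exact le_of_mul_le_mul_left h6 kap_pos

theorem fun_lim {R : ℝ} {hR : 0 < R} {δ : ℕ → ℝ} {f : ℕ → E2 → ℝ} {P : ℕ → E2 → ℂ} {F : ℕ → E2 → ℝ}
    {A B C : ℝ} (H : Resc R hR δ f P F A B C) {l : Filter ℕ} (hδ : Tendsto δ l (𝓝 0))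
    {P0 : E2 → ℂ} {g : E2 → ℝ} (hg0 : g 0 = 0) (hg : ∀ x, HasFDerivAt g (Lm (P0 x)) x)
    (hl : ∀ r ε : ℝ, 0 < r → 0 < ε → ∀ᶠ k in l, ∀ x ∈ ball (0 : E2) r, ‖P k x - P0 x‖ ≤ ε)
    (r ε : ℝ) (hr : 0 < r) (hε : 0 < ε) :
    ∀ᶠ k in l, ∀ x ∈ ball (0 : E2) r, |f k x - g x| ≤ ε := by
  filter_upwards [hl r (ε / r) hr (by positivity), small_ev hδ hR r] with k h1 h2 x hx
  have := (convex_ball (0 : E2) r).norm_image_sub_le_of_norm_hasFDerivWithin_le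
    (f := fun x => f k x - g x) (f' := fun x => Lm (P k x) - Lm (P0 x)) (C := ε / r)
    (fun x hx => ((H.hd k x (h2 x hx)).sub (hg x)).hasFDerivWithinAt)
    (fun x hx => by rw [← map_sub]; exact (Lm_norm_le _).trans (h1 x hx))
    (mem_ball_self hr) hx
  simp only [H.f0, hg0, sub_zero, Real.norm_eq_abs] at this
  have hx' : ‖x‖ < r := by simpa using hx
  refine this.trans ?_
  calc ε / r * ‖x‖ ≤ ε / r * r := by gcongr
    _ = ε := by field_simp

lemma P_bdd {R : ℝ} {hR : 0 < R} {δ : ℕ → ℝ} {f : ℕ → E2 → ℝ} {P : ℕ → E2 → ℂ} {F : ℕ → E2 → ℝ}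
    {A B C : ℝ} (H : Resc R hR δ f P F A B C) {l : Filter ℕ} (hδ : Tendsto δ l (𝓝 0)) :
    ∃ D : ℝ, 0 ≤ D ∧ ∀ r : ℝ, ∀ᶠ k in l, ∀ x ∈ ball (0 : E2) r, ‖P k x‖ ≤ D := by
  refine ⟨kap⁻¹ * (1 + (KK 1 * |B| + |C|)), ?_, fun r => ?_⟩
  · have := kap_pos; have := KK_nonneg 1; positivity
  have h2 : ∀ᶠ k in l, A * δ k < 1 := by
    have : Tendsto (fun k => A * δ k) l (𝓝 (A * 0)) := hδ.const_mul _
    rw [mul_zero] at this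
    exact this.eventually (gt_mem_nhds one_pos)
  filter_upwards [h2, small_ev hδ hR r] with k h2 h3 x hx
  have h4 := H.hP k x (h3 x hx)
  have i0 := bump_mul_integrable hR (δ k) (H.hi k) x
  have h5 := kern_le (F := fun y => ((bump R hR (δ k • (y - x)) * F k y : ℝ) : ℂ)) (B := |B|)
    i0.ofReal (fun y => by
      rw [Complex.norm_real]
      exact ((bump_mul_le hR _ _).trans (H.hB k y)).trans (le_abs_self B)) x
  have h6 : ∫ y, ‖((bump R hR (δ k • (y - x)) * F k y : ℝ) : ℂ)‖ ≤ |C| := by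
    refine le_trans ?_ ((H.hC k).trans (le_abs_self C))
    refine integral_mono i0.ofReal.norm (H.hi k).abs fun y => ?_
    simp only
    rw [Complex.norm_real]
    exact bump_mul_le hR _ _
  have h7 := norm_le_norm_add_norm_sub' ((kap : ℂ) * P k x)
    (∫ y, kc (y - x) * ((bump R hR (δ k • (y - x)) * F k y : ℝ) : ℂ))
  rw [norm_mul, Complex.norm_real, Real.norm_of_nonneg kap_pos.le] at h7
  rw [le_inv_mul_iff₀ kap_pos]
  linarith

lemma ultra_lim {l : Ultrafilter ℕ} {u : ℕ → ℝ} {D : ℝ} (h : ∀ᶠ k in (l : Filter ℕ), |u k| ≤ D) :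
    ∃ a, Tendsto u l (𝓝 a) := by
  have hm : Set.Icc (-D) D ∈ l.map u := by
    change ∀ᶠ k in (l : Filter ℕ), u k ∈ Set.Icc (-D) D
    filter_upwards [h] with k hk using abs_le.1 hk
  obtain ⟨a, _, ha⟩ := isCompact_Icc.ultrafilter_le_nhds' (l.map u) hm
  exact ⟨a, ha⟩

lemma exp_sub_le {a b : ℝ} (ha : a ≤ 0) (hb : b ≤ 0) : |Real.exp a - Real.exp b| ≤ |a - b| := by
  have key : ∀ s t : ℝ, t ≤ 0 → Real.exp t - Real.exp s ≤ |t - s| := fun s t ht => by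
    have h1 := Real.add_one_le_exp (s - t)
    have h2 : Real.exp s = Real.exp t * Real.exp (s - t) := by rw [← Real.exp_add]; ring_nf
    have h3 : Real.exp t ≤ 1 := Real.exp_le_one_iff.2 ht
    have h4 := Real.exp_pos t
    have h5 : Real.exp t * (s - t + 1) ≤ Real.exp s := by rw [h2]; gcongr
    have h6 : Real.exp t - Real.exp s ≤ Real.exp t * (t - s) := by linarith
    refine h6.trans ?_
    calc Real.exp t * (t - s) ≤ Real.exp t * |t - s| := by gcongr; exact le_abs_self _
      _ ≤ 1 * |t - s| := by gcongr
      _ = _ := one_mul _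
  rw [abs_le]
  constructor
  · have := key a b hb
    rw [abs_sub_comm] at this; linarith
  · exact key b a ha

theorem bubble {R : ℝ} {hR : 0 < R} {δ : ℕ → ℝ} {f : ℕ → E2 → ℝ} {P : ℕ → E2 → ℂ} {F : ℕ → E2 → ℝ}
    {A B C : ℝ} (H : Resc R hR δ f P F A B C) (hB1 : 1 ≤ B) (l : Ultrafilter ℕ)
    (hδ : Tendsto δ l (𝓝 0)) {a : ℕ → E2 → ℝ}
    (hle : ∀ k x, ‖δ k • x‖ < R / 4 → f k x ≤ 0)
    (hF : ∀ k x, ‖δ k • x‖ < R / 4 → F k x = a k x * Real.exp (f k x))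
    (ha : ∀ M η : ℝ, 0 < η → ∀ᶠ k in (l : Filter ℕ), ∀ y ∈ ball (0 : E2) M, |a k y - 1| ≤ η) :
    (∀ M η : ℝ, 0 < η → ∀ᶠ k in (l : Filter ℕ), ∀ y ∈ ball (0 : E2) M,
      |F k y - Real.exp (U y)| ≤ η) ∧ Integrable (fun y => Real.exp (U y)) ∧
    ∃ PU : E2 → ℂ, (∀ x, (kap : ℂ) * PU x = ∫ y, kc (y - x) * (Real.exp (U y) : ℂ)) ∧
      ∀ x, HasFDerivAt U (Lm (PU x)) x := by
  obtain ⟨D, hD0, hD⟩ := P_bdd H hδ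
  have hLip : ∀ r : ℝ, ∀ᶠ k in (l : Filter ℕ), ∀ x ∈ ball (0 : E2) r, ∀ y ∈ ball (0 : E2) r,
      |f k y - f k x| ≤ D * ‖y - x‖ := by
    intro r
    filter_upwards [hD r, small_ev hδ hR r] with k h1 h2 x hx y hy
    exact (convex_ball (0 : E2) r).norm_image_sub_le_of_norm_hasFDerivWithin_le
      (f := f k) (f' := fun x => Lm (P k x)) (C := D)
      (fun x hx => (H.hd k x (h2 x hx)).hasFDerivWithinAt)
      (fun x hx => (Lm_norm_le _).trans (h1 x hx)) hx hy
  have hpt : ∀ x, ∃ b, Tendsto (fun k => f k x) l (𝓝 b) := fun x => by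
    refine ultra_lim (D := D * ‖x‖) ?_
    filter_upwards [hLip (‖x‖ + 1)] with k hk
    have := hk 0 (by simp; positivity) x (by simp)
    simpa [H.f0] using this
  choose v hv using hpt
  have hv0 : v 0 = 0 := by
    have := hv 0
    simp only [H.f0] at this
    exact tendsto_nhds_unique this tendsto_const_nhds
  have hvle : ∀ x, v x ≤ 0 := fun x => by
    refine le_of_tendsto (hv x) ?_
    filter_upwards [small_ev hδ hR (‖x‖ + 1)] with k hk
    exact hle k x (hk x (by simp))
  have hvL : ∀ x y, |v y - v x| ≤ D * ‖y - x‖ := fun x y => by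
    refine le_of_tendsto ((hv y).sub (hv x)).abs ?_
    filter_upwards [hLip (‖x‖ + ‖y‖ + 1)] with k hk
    exact hk x (by rw [mem_ball_zero_iff]; linarith [norm_nonneg x, norm_nonneg y]) y
      (by rw [mem_ball_zero_iff]; linarith [norm_nonneg x, norm_nonneg y])
  have hvc : Continuous v := by
    have : LipschitzWith D.toNNReal v := LipschitzWith.of_dist_le_mul fun x y => by
      rw [Real.dist_eq, dist_eq_norm, Real.coe_toNNReal _ hD0]; exact hvL y x
    exact this.continuous
  have hunif : ∀ M η : ℝ, 0 < η → ∀ᶠ k in (l : Filter ℕ), ∀ y ∈ ball (0 : E2) M,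
      |f k y - v y| ≤ η := by
    intro M η hη
    obtain ⟨t, ht, htf, hcov⟩ := (isCompact_closedBall (0 : E2) M).finite_cover_balls
      (e := η / (3 * (D + 1))) (by positivity)
    have h1 : ∀ᶠ k in (l : Filter ℕ), ∀ p ∈ t, |f k p - v p| ≤ η / 3 := by
      rw [eventually_all_finite htf]
      intro p _
      have := (hv p).sub_const (v p)
      rw [sub_self] at this
      have h2 := this.abs
      rw [abs_zero] at h2
      exact (h2.eventually (gt_mem_nhds (by positivity : 0 < η / 3))).mono fun k hk => hk.le
    filter_upwards [h1, hLip (M + 1)] with k h1 h2 y hy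
    obtain ⟨p, hp, hyp⟩ := Set.mem_iUnion₂.1 (hcov (ball_subset_closedBall hy))
    have hpy : ‖y - p‖ < η / (3 * (D + 1)) := by rw [← dist_eq_norm]; exact hyp
    have hpM : p ∈ ball (0 : E2) (M + 1) := by
      have : ‖p‖ ≤ M := by simpa using ht hp
      simp; linarith
    have hyM : y ∈ ball (0 : E2) (M + 1) := ball_subset_ball (by linarith) hy
    have h3 := h2 p hpM y hyM
    have h4 := hvL p y
    have h5 := h1 p hp
    have h6 : D * ‖y - p‖ ≤ η / 3 := by
      have : D * ‖y - p‖ ≤ (D + 1) * (η / (3 * (D + 1))) := by gcongr; linarith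
      refine this.trans (le_of_eq ?_)
      field_simp
    rw [show f k y - v y = (f k y - f k p) + (f k p - v p) - (v y - v p) by ring]
    refine (abs_sub _ _).trans ?_
    refine (add_le_add_left (abs_add_le _ _) _).trans ?_
    linarith
  have hFv : ∀ M η : ℝ, 0 < η → ∀ᶠ k in (l : Filter ℕ), ∀ y ∈ ball (0 : E2) M,
      |F k y - Real.exp (v y)| ≤ η := by
    intro M η hη
    filter_upwards [hunif M (η / 2) (by positivity), ha M (η / 2) (by positivity),
      small_ev hδ hR M] with k h1 h2 h3 y hy
    have hfl := hle k y (h3 y hy)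
    rw [hF k y (h3 y hy), show a k y * Real.exp (f k y) - Real.exp (v y)
      = (a k y - 1) * Real.exp (f k y) + (Real.exp (f k y) - Real.exp (v y)) by ring]
    refine (abs_add_le _ _).trans ?_
    have h4 := (exp_sub_le hfl (hvle y)).trans (h1 y hy)
    rw [abs_mul, abs_of_pos (Real.exp_pos _)]
    have h5 : |a k y - 1| * Real.exp (f k y) ≤ (η / 2) * 1 :=
      mul_le_mul (h2 y hy) (Real.exp_le_one_iff.2 hfl) (Real.exp_pos _).le (by positivity)
    linarith
  have hec : Continuous (fun y => Real.exp (v y)) := Real.continuous_exp.comp hvc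
  have hion : ∀ M : ℝ, IntegrableOn (fun y => Real.exp (v y)) (ball 0 M) := fun M =>
    (hec.continuousOn.integrableOn_compact (isCompact_closedBall 0 M)).mono_set
      ball_subset_closedBall
  have hIntg : Integrable (fun y => Real.exp (v y)) := by
    refine (aecover_ball (x := (0 : E2)) (μ := volume) tendsto_id).integrable_of_integral_bounded_of_nonneg_ae
      (l := (atTop : Filter ℝ)) (C + 1)
      (fun M => hion M) (Eventually.of_forall fun _ => (Real.exp_pos _).le)
      (Eventually.of_forall fun M => ?_)
    simp only [id]
    set vol := (volume : Measure E2).real (ball 0 M) with hvol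
    have hvol0 : 0 ≤ vol := measureReal_nonneg
    obtain ⟨k, hk⟩ := (hFv M (1 / (vol + 1)) (by positivity)).exists
    have h1 : ∫ y in ball 0 M, Real.exp (v y) ≤ ∫ y in ball 0 M, (|F k y| + 1 / (vol + 1)) := by
      refine setIntegral_mono_on (hion M) ((H.hi k).abs.integrableOn.add
        (integrableOn_const (measure_ball_lt_top.ne))) measurableSet_ball fun y hy => ?_
      have := (abs_le.1 (hk y hy)).1
      linarith [le_abs_self (F k y)]
    rw [integral_add (H.hi k).abs.integrableOn (integrableOn_const (measure_ball_lt_top.ne)),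
      setIntegral_const, smul_eq_mul, ← hvol] at h1
    have h2 : ∫ y in ball 0 M, |F k y| ≤ ∫ y, |F k y| :=
      setIntegral_le_integral (H.hi k).abs (Eventually.of_forall fun _ => abs_nonneg _)
    have h3 : vol * (1 / (vol + 1)) ≤ 1 := by
      rw [mul_one_div, div_le_one (by positivity)]; linarith
    linarith [H.hC k]
  set P0 : E2 → ℂ := fun x => (kap : ℂ)⁻¹ * ∫ y, kc (y - x) * (Real.exp (v y) : ℂ) with hP0
  have hk : (kap : ℂ) ≠ 0 := by exact_mod_cast kap_pos.ne'
  have hP0e : ∀ x, (kap : ℂ) * P0 x = ∫ y, kc (y - x) * (Real.exp (v y) : ℂ) := fun x => by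
    simp only [hP0]; field_simp
  have hgl := grad_lim H hδ hIntg (fun y => by
    rw [abs_of_pos (Real.exp_pos _)]
    exact (Real.exp_le_one_iff.2 (hvle y)).trans hB1) hFv hP0e
  have hder : ∀ x, HasFDerivAt v (Lm (P0 x)) x := by
    intro x
    have hxb : ball (0 : E2) (‖x‖ + 1) ∈ 𝓝 x := isOpen_ball.mem_nhds (by simp)
    refine hasFDerivAt_of_tendstoUniformlyOnFilter (𝕜 := ℝ) (l := (l : Filter ℕ)) (f := f)
      (f' := fun k x => Lm (P k x)) (g' := fun x => Lm (P0 x)) ?_ ?_ (Eventually.of_forall hv)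
    · rw [Metric.tendstoUniformlyOnFilter_iff]
      intro ε hε
      have h1 := hgl (‖x‖ + 1) (ε / 2) (by positivity) (by positivity)
      refine mem_of_superset (prod_mem_prod h1 hxb) ?_
      rintro ⟨k, y⟩ ⟨hk, hy⟩
      simp only [Set.mem_ofPred_eq] at hk ⊢
      rw [dist_comm, dist_eq_norm, ← map_sub]
      exact ((Lm_norm_le _).trans (hk y hy)).trans_lt (by linarith)
    · refine mem_of_superset (prod_mem_prod (small_ev hδ hR (‖x‖ + 1)) hxb) ?_
      rintro ⟨k, y⟩ ⟨hk, hy⟩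
      exact H.hd k y (hk y hy)
  have hvU := classify_U hIntg hvle hv0 hP0e hder
  subst hvU
  exact ⟨hFv, hIntg, P0, hP0e, hder⟩

lemma U_zero : U 0 = 0 := by simp [U]

lemma exp_U_le (x : E2) : Real.exp (U x) ≤ 1 := by
  rw [Real.exp_le_one_iff, U]
  refine Real.log_nonpos (by positivity) ?_
  rw [div_le_one (by positivity)]
  have : (0 : ℝ) ≤ ‖x‖ ^ 2 := by positivity
  nlinarith

/-- the complete local statement -/
theorem local_main {R : ℝ} {hR : 0 < R} {δ : ℕ → ℝ}
    {f : ℕ → E2 → ℝ} {P : ℕ → E2 → ℂ} {F : ℕ → E2 → ℝ} {A B C : ℝ}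
    (H : Resc R hR δ f P F A B C) (hB1 : 1 ≤ B) (hδ : Tendsto δ atTop (𝓝 0)) {a : ℕ → E2 → ℝ}
    (hle : ∀ k x, ‖δ k • x‖ < R / 4 → f k x ≤ 0)
    (hF : ∀ k x, ‖δ k • x‖ < R / 4 → F k x = a k x * Real.exp (f k x))
    (ha : ∀ M η : ℝ, 0 < η → ∀ᶠ k in (atTop : Filter ℕ), ∀ y ∈ ball (0 : E2) M, |a k y - 1| ≤ η)
    {z : ℕ → E2 → ℝ} {Q : ℕ → E2 → ℂ} {W : ℕ → E2 → ℝ} {A' : ℝ}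
    (H' : Resc R hR δ z Q (fun k y => F k y * W k y) A' B C) {c : ℝ} (hW1 : ∀ k y, |W k y| ≤ 1)
    (hW : ∀ M η : ℝ, 0 < η → ∀ᶠ k in (atTop : Filter ℕ), ∀ y ∈ ball (0 : E2) M, |W k y - c| ≤ η)
    (r ε : ℝ) (hr : 0 < r) (hε : 0 < ε) :
    ∀ᶠ k in (atTop : Filter ℕ), ∀ x ∈ ball (0 : E2) r, |z k x - c * U x| ≤ ε := by
  have hb := fun (l : Ultrafilter ℕ) (hl : (l : Filter ℕ) ≤ atTop) =>
    bubble H hB1 l (hδ.mono_left hl) hle hF (fun M η hη => hl (ha M η hη))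
  have hFU : ∀ M η : ℝ, 0 < η → ∀ᶠ k in (atTop : Filter ℕ), ∀ y ∈ ball (0 : E2) M,
      |F k y - Real.exp (U y)| ≤ η := by
    intro M η hη
    refine Filter.mem_iff_ultrafilter.2 fun l hl => ?_
    exact (hb l hl).1 M η hη
  obtain ⟨_, hUi, PU, hPU, hUd⟩ := hb (Ultrafilter.of atTop) (Ultrafilter.of_le _)
  have hc1 : |c| ≤ 1 := by
    refine le_of_forall_pos_le_add fun ε hε => ?_
    obtain ⟨k, hk⟩ := (hW 1 ε hε).exists
    have h1 := hk 0 (mem_ball_self one_pos)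
    have h2 := hW1 k 0
    have h3 := abs_sub_abs_le_abs_sub c (W k 0)
    rw [abs_sub_comm] at h3
    linarith
  have hlim : ∀ M η : ℝ, 0 < η → ∀ᶠ k in (atTop : Filter ℕ), ∀ y ∈ ball (0 : E2) M,
      |F k y * W k y - Real.exp (U y) * c| ≤ η := by
    intro M η hη
    filter_upwards [hFU M (η / 2) (by positivity), hW M (η / 2) (by positivity)] with k h1 h2 y hy
    rw [show F k y * W k y - Real.exp (U y) * c
      = (F k y - Real.exp (U y)) * W k y + Real.exp (U y) * (W k y - c) by ring]
    refine (abs_add_le _ _).trans ?_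
    rw [abs_mul, abs_mul, abs_of_pos (Real.exp_pos _)]
    have h3 : |F k y - Real.exp (U y)| * |W k y| ≤ η / 2 * 1 :=
      mul_le_mul (h1 y hy) (hW1 k y) (abs_nonneg _) (by positivity)
    have h4 : Real.exp (U y) * |W k y - c| ≤ 1 * (η / 2) :=
      mul_le_mul (exp_U_le y) (h2 y hy) (abs_nonneg _) zero_le_one
    linarith
  have hg := grad_lim H' hδ (F0 := fun y => Real.exp (U y) * c) (hUi.mul_const c) (fun y => by
    rw [abs_mul, abs_of_pos (Real.exp_pos _)]
    exact (mul_le_mul (exp_U_le y) hc1 (abs_nonneg _) zero_le_one).trans (by linarith)) hlim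
    (P0 := fun x => PU x * c) (fun x => by
      rw [← mul_assoc, hPU, ← integral_mul_const]
      congr 1; funext y; push_cast; ring)
  refine fun_lim H' hδ (g := fun x => c * U x) (by simp [U_zero]) (fun x => ?_) hg r ε hr hε
  have h1 := (hUd x).const_mul c
  have h2 : Lm (PU x * c) = c • Lm (PU x) := by
    rw [← map_smul, Complex.real_smul, mul_comm]
  rw [h2]; exact h1

lemma pd_contDiffAt {f : E2 → ℝ} {x : E2} (hf : ContDiffAt ℝ 2 f x) (e : E2) :
    ContDiffAt ℝ 1 (fun y => fderiv ℝ f y e) x :=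
  (hf.fderiv_right (m := 1) (by norm_num)).clm_apply contDiffAt_const

lemma ev_diff {f : E2 → ℝ} {x : E2} (hf : ContDiffAt ℝ 2 f x) :
    ∀ᶠ y in 𝓝 x, DifferentiableAt ℝ f y := by
  filter_upwards [hf.eventually (by simp)] with y hy using hy.differentiableAt (by simp)

lemma lap_lin {f g : E2 → ℝ} {x : E2} (hf : ContDiffAt ℝ 2 f x) (hg : ContDiffAt ℝ 2 g x)
    (a b : ℝ) : lap (fun y => a * f y + b * g y) x = a * lap f x + b * lap g x := by
  unfold lap
  rw [Finset.mul_sum, Finset.mul_sum, ← Finset.sum_add_distrib]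
  refine Finset.sum_congr rfl fun i _ => ?_
  set e : E2 := EuclideanSpace.single i 1
  have h1 : (fun y => fderiv ℝ (fun y => a * f y + b * g y) y e)
      =ᶠ[𝓝 x] fun y => a * fderiv ℝ f y e + b * fderiv ℝ g y e := by
    filter_upwards [ev_diff hf, ev_diff hg] with y h1 h2
    have h3 : HasFDerivAt (fun y => a * f y + b * g y) (a • fderiv ℝ f y + b • fderiv ℝ g y) y :=
      (h1.hasFDerivAt.const_mul a).add (h2.hasFDerivAt.const_mul b)
    rw [h3.fderiv]
    simp
  rw [h1.fderiv_eq]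
  have h2 := ((pd_contDiffAt hf e).differentiableAt (by simp)).hasFDerivAt
  have h3 := ((pd_contDiffAt hg e).differentiableAt (by simp)).hasFDerivAt
  have h4 : HasFDerivAt (fun y => a * fderiv ℝ f y e + b * fderiv ℝ g y e) _ x :=
    (h2.const_mul a).add (h3.const_mul b)
  rw [h4.fderiv]
  simp

lemma lap_normsq (x : E2) : lap (fun y => ‖y‖ ^ 2) x = 4 := by
  unfold lap
  have h : ∀ i : Fin 2, (fun y : E2 => fderiv ℝ (fun y : E2 => ‖y‖ ^ 2) y (EuclideanSpace.single i 1))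
      = fun y => 2 * (innerSL ℝ (ee i)) y := fun i => by
    funext y
    rw [(normsq_hasFDerivAt y).fderiv]
    simp only [_root_.smul_apply, innerSL_apply_apply, nsmul_eq_mul]
    rw [real_inner_comm]; norm_num
  simp_rw [h]
  have h2 : ∀ i : Fin 2, fderiv ℝ (fun y : E2 => 2 * (innerSL ℝ (ee i)) y) x (EuclideanSpace.single i 1) = 2 := by
    intro i
    rw [((innerSL ℝ (ee i)).hasFDerivAt.const_mul 2).fderiv]
    simp
  simp_rw [h2]
  norm_num

lemma lap_const (a : ℝ) (x : E2) : lap (fun _ => a) x = 0 := by simp [lap]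

lemma second_deriv_nonneg {g : ℝ → ℝ} {x : ℝ} (h : IsLocalMin g x) (hc : ContinuousAt g x) :
    0 ≤ deriv (deriv g) x := by
  by_contra hn
  have hM := isLocalMax_of_deriv_deriv_neg (not_le.1 hn) h.deriv_eq_zero hc
  have he : g =ᶠ[𝓝 x] fun _ => g x := by
    filter_upwards [h, hM] with y h1 h2 using le_antisymm h2 h1
  have h2 : deriv (deriv g) x = 0 := by
    rw [he.deriv.deriv_eq]; simp
  exact hn h2.ge

lemma lap_nonneg_of_min {t : E2 → ℝ} {x : E2} (ht : ContDiffAt ℝ 2 t x) (h : IsLocalMin t x) :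
    0 ≤ lap t x := by
  unfold lap
  refine Finset.sum_nonneg fun i _ => ?_
  set e : E2 := EuclideanSpace.single i 1
  have hl : ∀ τ : ℝ, HasDerivAt (fun τ : ℝ => x + τ • e) e τ := fun τ => by
    simpa using ((hasDerivAt_id τ).smul_const e).const_add x
  have hx0 : x + (0 : ℝ) • e = x := by simp
  have htend : Tendsto (fun τ : ℝ => x + τ • e) (𝓝 0) (𝓝 x) := by
    have := (hl 0).continuousAt.tendsto
    rwa [hx0] at this
  set g : ℝ → ℝ := fun τ => t (x + τ • e) with hg
  have hg1 : deriv g =ᶠ[𝓝 0] fun τ => fderiv ℝ t (x + τ • e) e := by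
    filter_upwards [htend.eventually (ev_diff ht)] with τ hτ
    exact (hτ.hasFDerivAt.comp_hasDerivAt τ (hl τ)).deriv
  have hmin : IsLocalMin g 0 := by
    have := htend.eventually h
    simpa [IsLocalMin, IsMinFilter, hg] using this
  have hgc : ContinuousAt g 0 := by
    have h1 : ContinuousAt t (x + (0 : ℝ) • e) := by rw [hx0]; exact ht.continuousAt
    exact ContinuousAt.comp (f := fun τ : ℝ => x + τ • e) h1 (hl 0).continuousAt
  have h2 := second_deriv_nonneg hmin hgc
  rw [hg1.deriv_eq] at h2
  have h3 : HasFDerivAt (fun y => fderiv ℝ t y e) (fderiv ℝ (fun y => fderiv ℝ t y e) x)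
      (x + (0 : ℝ) • e) := by
    rw [hx0]; exact ((pd_contDiffAt ht e).differentiableAt (by simp)).hasFDerivAt
  have h4 := (h3.comp_hasDerivAt (0 : ℝ) (hl 0)).deriv
  simp only [Function.comp_def] at h4
  rwa [h4] at h2

theorem max_principle {Ω : Set E2} (hΩ : IsOpen Ω) (hb : IsBounded Ω) {s : E2 → ℝ}
    (hs : ContDiffOn ℝ 2 s Ω) (hc : ContinuousOn s (closure Ω)) (hlap : ∀ x ∈ Ω, lap s x ≤ 0)
    (hbc : ∀ x ∈ frontier Ω, 0 ≤ s x) : ∀ x ∈ closure Ω, 0 ≤ s x := by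
  intro x0 hx0
  by_contra hn
  have hn : s x0 < 0 := not_le.1 hn
  have hcomp : IsCompact (closure Ω) := hb.isCompact_closure
  obtain ⟨D, hD⟩ := hcomp.isBounded.exists_norm_le
  have hD0 : 0 ≤ D := (norm_nonneg _).trans (hD x0 hx0)
  set ε : ℝ := - s x0 / (D ^ 2 + 1) with hε
  have hε0 : 0 < ε := div_pos (by linarith) (by positivity)
  have hεD : ε * D ^ 2 < - s x0 := by
    have : ε * (D ^ 2 + 1) = - s x0 := by rw [hε]; field_simp
    linarith
  set t : E2 → ℝ := fun x => 1 * s x + (-ε) * ‖x‖ ^ 2 with ht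
  obtain ⟨x1, hx1, hmin⟩ := hcomp.exists_isMinOn ⟨x0, hx0⟩
    (show ContinuousOn t (closure Ω) from (continuousOn_const.mul hc).add (by fun_prop))
  have h1 : t x1 ≤ t x0 := hmin hx0
  have h2 : t x1 ≤ s x0 := h1.trans (by simp only [ht]; nlinarith [sq_nonneg ‖x0‖])
  have hx1Ω : x1 ∈ Ω := by
    by_contra hx
    have hf : x1 ∈ frontier Ω := by rw [hΩ.frontier_eq]; exact ⟨hx1, hx⟩
    have h3 := hbc x1 hf
    have h4 : ‖x1‖ ^ 2 ≤ D ^ 2 := pow_le_pow_left₀ (norm_nonneg _) (hD x1 hx1) 2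
    simp only [ht] at h2
    nlinarith
  have hsx : ContDiffAt ℝ 2 s x1 := (hs x1 hx1Ω).contDiffAt (hΩ.mem_nhds hx1Ω)
  have hqx : ContDiffAt ℝ 2 (fun y : E2 => ‖y‖ ^ 2) x1 := (contDiff_norm_sq ℝ).contDiffAt
  have hlm : IsLocalMin t x1 := by
    filter_upwards [hΩ.mem_nhds hx1Ω] with y hy using hmin (subset_closure hy)
  have h5 := lap_nonneg_of_min ((contDiffAt_const.mul hsx).add (contDiffAt_const.mul hqx)) hlm
  rw [lap_lin hsx hqx, lap_normsq] at h5
  linarith [hlap x1 hx1Ω]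

lemma green_id {q g : E2 → ℝ} (hq : ContDiff ℝ 2 q) (hg : ContDiff ℝ 2 g)
    (hc : HasCompactSupport g) : ∫ x, q x * lap g x = ∫ x, lap q x * g x := by
  have cq := hq.continuous
  have cg := hg.continuous
  have cdq : ∀ e, ContDiff ℝ 1 (fun y => fderiv ℝ q y e) := fun e =>
    (hq.fderiv_right (m := 1) (by norm_num)).clm_apply contDiff_const
  have cdg : ∀ e, ContDiff ℝ 1 (fun y => fderiv ℝ g y e) := fun e =>
    (hg.fderiv_right (m := 1) (by norm_num)).clm_apply contDiff_const
  have cq1 := fun e => (cdq e).continuous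
  have cg1 := fun e => (cdg e).continuous
  have cq2 := fun e => (cdq e).continuous_fderiv one_ne_zero
  have cg2 := fun e => (cdg e).continuous_fderiv one_ne_zero
  have s1 : ∀ e, HasCompactSupport (fun y => fderiv ℝ g y e) := fun e => hcs_fderiv_apply hc e
  have s2 : ∀ e e', HasCompactSupport (fun x => fderiv ℝ (fun y => fderiv ℝ g y e) x e') :=
    fun e e' => hcs_fderiv_apply (s1 e) e'
  have i0 : ∀ e, Integrable (fun x => q x * fderiv ℝ (fun y => fderiv ℝ g y e) x e) := fun e =>
    (cq.mul ((cg2 e).clm_apply continuous_const)).integrable_of_hasCompactSupport (s2 e e).mul_left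
  have i1 : ∀ e, Integrable (fun x => fderiv ℝ q x e * fderiv ℝ g x e) := fun e =>
    ((cq1 e).mul (cg1 e)).integrable_of_hasCompactSupport (s1 e).mul_left
  have i2 : ∀ e, Integrable (fun x => q x * fderiv ℝ g x e) := fun e =>
    (cq.mul (cg1 e)).integrable_of_hasCompactSupport (s1 e).mul_left
  have i3 : ∀ e, Integrable (fun x => fderiv ℝ (fun y => fderiv ℝ q y e) x e * g x) := fun e =>
    (((cq2 e).clm_apply continuous_const).mul cg).integrable_of_hasCompactSupport hc.mul_left
  have i4 : ∀ e, Integrable (fun x => fderiv ℝ q x e * g x) := fun e =>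
    ((cq1 e).mul cg).integrable_of_hasCompactSupport hc.mul_left
  have key : ∀ e, ∫ x, q x * fderiv ℝ (fun y => fderiv ℝ g y e) x e
      = ∫ x, fderiv ℝ (fun y => fderiv ℝ q y e) x e * g x := fun e => by
    have h1 := integral_mul_fderiv_eq_neg_fderiv_mul_of_integrable (𝕜 := ℝ) (f := q)
      (g := fun y => fderiv ℝ g y e) (v := e) (i1 e) (i0 e) (i2 e)
      (fun x _ => (hq.differentiable (by simp)) x)
      (fun x _ => ((cdg e).differentiable (by simp)) x)
    have h2 := integral_mul_fderiv_eq_neg_fderiv_mul_of_integrable (𝕜 := ℝ)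
      (f := fun y => fderiv ℝ q y e) (g := g) (v := e) (i3 e) (i1 e) (i4 e)
      (fun x _ => ((cdq e).differentiable (by simp)) x)
      (fun x _ => (hg.differentiable (by simp)) x)
    rw [h1, h2, neg_neg]
  unfold lap
  simp_rw [Finset.mul_sum, Finset.sum_mul]
  rw [integral_finsetSum _ fun i _ => i0 _, integral_finsetSum _ fun i _ => i3 _]
  exact Finset.sum_congr rfl fun i _ => key _

lemma hasDerivAt_max {g g' : ℝ → ℝ} (hg : ∀ t, HasDerivAt g (g' t) t) (h0 : g 0 = 0) (h1 : g' 0 = 0)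
    (t : ℝ) : HasDerivAt (fun t => g (max t 0)) (g' (max t 0)) t := by
  rcases lt_trichotomy t 0 with h | h | h
  · have e : (fun t => g (max t 0)) =ᶠ[𝓝 t] fun _ => g 0 := by
      filter_upwards [gt_mem_nhds h] with s hs
      rw [max_eq_right (le_of_lt hs)]
    rw [max_eq_right h.le, h1]
    exact (hasDerivAt_const t (g 0)).congr_of_eventuallyEq e
  · subst h
    rw [max_self, h1]
    have a1 : HasDerivWithinAt (fun t => g (max t 0)) 0 (Set.Iic 0) 0 := by
      refine (hasDerivWithinAt_const (0 : ℝ) (Set.Iic 0) (g 0)).congr (fun s hs => ?_) (by simp)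
      rw [max_eq_right hs]
    have a2 : HasDerivWithinAt (fun t => g (max t 0)) 0 (Set.Ici 0) 0 := by
      have := (hg 0).hasDerivWithinAt (s := Set.Ici 0)
      rw [h1] at this
      refine this.congr (fun s hs => ?_) (by simp)
      rw [max_eq_left hs]
    have := a1.union a2
    rw [Set.Iic_union_Ici] at this
    exact hasDerivWithinAt_univ.1 this
  · have e : (fun t => g (max t 0)) =ᶠ[𝓝 t] g := by
      filter_upwards [lt_mem_nhds h] with s hs
      rw [max_eq_left (le_of_lt hs)]
    rw [max_eq_left h.le]
    exact (hg t).congr_of_eventuallyEq e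

/-- convex truncation -/
def Phi (t : ℝ) : ℝ := max (t - 1) 0 - Real.arctan (max (t - 1) 0)
def Phi1 (t : ℝ) : ℝ := 1 - 1 / (1 + max (t - 1) 0 ^ 2)
def Phi2 (t : ℝ) : ℝ := 2 * max (t - 1) 0 / (1 + max (t - 1) 0 ^ 2) ^ 2

lemma Phi_deriv (t : ℝ) : HasDerivAt Phi (Phi1 t) t := by
  have h := hasDerivAt_max (g := fun s => s - Real.arctan s) (g' := fun s => 1 - 1 / (1 + s ^ 2))
    (fun s => (hasDerivAt_id s).sub (Real.hasDerivAt_arctan s)) (by simp) (by simp) (t - 1)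
  exact HasDerivAt.comp_sub_const t 1 h

lemma Phi1_deriv (t : ℝ) : HasDerivAt Phi1 (Phi2 t) t := by
  have h := hasDerivAt_max (g := fun s => 1 - 1 / (1 + s ^ 2)) (g' := fun s => 2 * s / (1 + s ^ 2) ^ 2)
    (fun s => by
      have hp : (1 + s ^ 2) ≠ 0 := by positivity
      have h1 : HasDerivAt (fun s : ℝ => 1 + s ^ 2) (2 * s) s := by
        simpa using (hasDerivAt_pow 2 s).const_add 1
      have h2 := (h1.inv hp).const_sub 1
      simp only [one_div]
      refine h2.congr_deriv ?_
      rw [neg_div, neg_neg]) (by simp) (by simp) (t - 1)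
  exact HasDerivAt.comp_sub_const t 1 h

lemma Phi2_cont : Continuous Phi2 := by
  unfold Phi2
  refine Continuous.div (by fun_prop) (by fun_prop) fun t => by positivity

lemma Phi2_nonneg (t : ℝ) : 0 ≤ Phi2 t := by unfold Phi2; positivity

lemma Phi1_le (t : ℝ) : Phi1 t ≤ 1 := by
  have : 0 ≤ 1 / (1 + max (t - 1) 0 ^ 2) := by positivity
  unfold Phi1; linarith

lemma Phi1_nonneg (t : ℝ) : 0 ≤ Phi1 t := by
  have : 1 / (1 + max (t - 1) 0 ^ 2) ≤ 1 := by
    rw [div_le_one (by positivity)]; nlinarith [sq_nonneg (max (t - 1) 0)]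
  unfold Phi1; linarith

lemma Phi_zero {t : ℝ} (h : t ≤ 1) : Phi t = 0 := by
  unfold Phi; rw [max_eq_right (by linarith)]; simp

lemma Phi_nonneg (t : ℝ) : 0 ≤ Phi t := by
  have hm : Monotone Phi := monotone_of_deriv_nonneg (fun t => (Phi_deriv t).differentiableAt)
    fun t => by rw [(Phi_deriv t).deriv]; exact Phi1_nonneg t
  rcases le_total t 1 with h | h
  · rw [Phi_zero h]
  · rw [← Phi_zero (le_refl (1:ℝ))]; exact hm h

lemma Phi_ge (t : ℝ) : t ≤ Phi t + (1 + π / 2) := by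
  unfold Phi
  have := Real.arctan_lt_pi_div_two (max (t - 1) 0)
  have := le_max_left (t - 1) 0
  linarith

lemma Phi_contDiff : ContDiff ℝ 2 Phi := by
  have d0 : deriv Phi = Phi1 := funext fun t => (Phi_deriv t).deriv
  have d1 : deriv Phi1 = Phi2 := funext fun t => (Phi1_deriv t).deriv
  rw [show (2 : WithTop ℕ∞) = 1 + 1 by norm_num, contDiff_succ_iff_deriv]
  refine ⟨fun t => (Phi_deriv t).differentiableAt, by simp, ?_⟩
  rw [d0, contDiff_one_iff_deriv, d1]
  exact ⟨fun t => (Phi1_deriv t).differentiableAt, Phi2_cont⟩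

lemma lap_Phi {v : E2 → ℝ} {x : E2} (hv : ContDiffAt ℝ 2 v x) :
    Phi1 (v x) * lap v x ≤ lap (fun y => Phi (v y)) x := by
  unfold lap
  rw [Finset.mul_sum]
  refine Finset.sum_le_sum fun i _ => ?_
  set e : E2 := EuclideanSpace.single i 1
  have h1 : (fun y => fderiv ℝ (fun y => Phi (v y)) y e)
      =ᶠ[𝓝 x] fun y => Phi1 (v y) * fderiv ℝ v y e := by
    filter_upwards [ev_diff hv] with y hy
    have : HasFDerivAt (fun y => Phi (v y)) (Phi1 (v y) • fderiv ℝ v y) y :=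
      (Phi_deriv (v y)).comp_hasFDerivAt y hy.hasFDerivAt
    rw [this.fderiv]; simp
  rw [h1.fderiv_eq]
  have h2 : HasFDerivAt (fun y => Phi1 (v y)) (Phi2 (v x) • fderiv ℝ v x) x :=
    (Phi1_deriv (v x)).comp_hasFDerivAt x (hv.differentiableAt (by simp)).hasFDerivAt
  have h3 := ((pd_contDiffAt hv e).differentiableAt (by simp)).hasFDerivAt
  have h4 : HasFDerivAt (fun y => Phi1 (v y) * fderiv ℝ v y e) _ x := h2.mul h3
  rw [h4.fderiv]
  simp only [_root_.add_apply, _root_.smul_apply, smul_eq_mul]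
  have h5 : 0 ≤ fderiv ℝ v x e * (Phi2 (v x) * fderiv ℝ v x e) := by
    have := mul_nonneg (Phi2_nonneg (v x)) (mul_self_nonneg (fderiv ℝ v x e))
    linarith
  linarith

open Classical in
theorem L1_bound {Ω : Set E2} (hΩ : IsOpen Ω) (hb : IsBounded Ω) {D : ℝ} (hD : ∀ x ∈ closure Ω, ‖x‖ ≤ D)
    {v : E2 → ℝ} (hv : ContDiffOn ℝ 2 v Ω) (hc : ContinuousOn v (closure Ω))
    (hbc : ∀ x ∈ frontier Ω, v x = 0) {ρ : E2 → ℝ} (hρ : ∀ x ∈ Ω, -lap v x = ρ x)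
    (hρ0 : ∀ x ∈ Ω, 0 ≤ ρ x) (hρi : IntegrableOn ρ Ω) :
    ∫ x in Ω, v x ≤ D ^ 2 / 4 * (∫ x in Ω, ρ x) + (1 + π / 2) * (volume : Measure E2).real Ω := by
  have hcomp : IsCompact (closure Ω) := hb.isCompact_closure
  set K : Set E2 := {x ∈ closure Ω | 1 ≤ v x} with hK
  have hKc : IsCompact K := by
    refine hcomp.of_isClosed_subset ?_ (fun x hx => hx.1)
    exact hc.preimage_isClosed_of_isClosed isClosed_closure isClosed_Ici
  have hKΩ : K ⊆ Ω := by
    rintro x ⟨hx, h1⟩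
    by_contra hn
    have hf : x ∈ frontier Ω := by rw [hΩ.frontier_eq]; exact ⟨hx, hn⟩
    rw [hbc x hf] at h1
    linarith
  set g : E2 → ℝ := fun x => if x ∈ Ω then Phi (v x) else 0 with hg
  have hgK : ∀ x, x ∉ K → g x = 0 := fun x hx => by
    simp only [hg]
    split_ifs with h
    · refine Phi_zero ?_
      by_contra hn
      exact hx ⟨subset_closure h, (not_le.1 hn).le⟩
    · rfl
  have hgc : HasCompactSupport g := HasCompactSupport.intro hKc hgK
  have hgev : ∀ x ∉ K, g =ᶠ[𝓝 x] fun _ => 0 := fun x hx => by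
    filter_upwards [hKc.isClosed.isOpen_compl.mem_nhds hx] with y hy using hgK y hy
  have hgΩ : ∀ x ∈ Ω, g =ᶠ[𝓝 x] fun y => Phi (v y) := fun x hx => by
    filter_upwards [hΩ.mem_nhds hx] with y hy
    simp [hg, hy]
  have hvx : ∀ x ∈ Ω, ContDiffAt ℝ 2 v x := fun x hx => (hv x hx).contDiffAt (hΩ.mem_nhds hx)
  have hg2 : ContDiff ℝ 2 g := by
    rw [contDiff_iff_contDiffAt]
    intro x
    by_cases hx : x ∈ Ω
    · exact (Phi_contDiff.contDiffAt.comp x (hvx x hx)).congr_of_eventuallyEq (hgΩ x hx)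
    · exact contDiffAt_const.congr_of_eventuallyEq (hgev x fun h => hx (hKΩ h))
  set q : E2 → ℝ := fun x => (-(1/4)) * ‖x‖ ^ 2 + 1 * (fun _ => D ^ 2 / 4) x with hq
  have hq2 : ContDiff ℝ 2 q :=
    (contDiff_const.mul (contDiff_norm_sq ℝ)).add (contDiff_const.mul contDiff_const)
  have hlq : ∀ x, lap q x = -1 := fun x => by
    rw [hq, lap_lin (contDiff_norm_sq ℝ).contDiffAt contDiffAt_const, lap_normsq, lap_const]
    norm_num
  have hgr := green_id hq2 hg2 hgc
  simp_rw [hlq] at hgr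
  rw [integral_const_mul] at hgr
  have hlc : Continuous (lap g) := lap_continuous hg2
  have hls : HasCompactSupport (lap g) := HasCompactSupport.intro hKc fun x hx => by
    rw [lap_congr (hgev x hx), lap_const]
  have i1 : Integrable (fun x => q x * lap g x) :=
    (hq2.continuous.mul hlc).integrable_of_hasCompactSupport hls.mul_left
  have hmain : ∫ x, -(q x * lap g x) ≤ ∫ x, Ω.indicator (fun x => D ^ 2 / 4 * ρ x) x := by
    refine integral_mono i1.neg ((integrable_indicator_iff hΩ.measurableSet).2
      (hρi.const_mul _)) fun x => ?_
    by_cases hx : x ∈ Ω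
    · simp only [Set.indicator_of_mem hx]
      rw [lap_congr (hgΩ x hx)]
      have h1 := lap_Phi (hvx x hx)
      have h2 := hρ x hx
      have h3 := hρ0 x hx
      have h4 := Phi1_le (v x)
      have h5 := Phi1_nonneg (v x)
      have h6 : ‖x‖ ^ 2 ≤ D ^ 2 :=
        pow_le_pow_left₀ (norm_nonneg _) (hD x (subset_closure hx)) 2
      have hq0 : 0 ≤ q x := by simp only [hq]; linarith
      have hq1 : q x ≤ D ^ 2 / 4 := by simp only [hq]; nlinarith [sq_nonneg ‖x‖]
      have h7 : - lap (fun y => Phi (v y)) x ≤ ρ x := by nlinarith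
      nlinarith
    · rw [Set.indicator_of_notMem hx, lap_congr (hgev x fun h => hx (hKΩ h)), lap_const]; simp
  rw [integral_neg, hgr, integral_indicator hΩ.measurableSet, integral_const_mul] at hmain
  have hgi : Integrable g := hg2.continuous.integrable_of_hasCompactSupport hgc
  have hvol : volume Ω ≠ ⊤ := hb.measure_lt_top.ne
  have hvi : IntegrableOn v Ω := (hc.integrableOn_compact hcomp).mono_set subset_closure
  have h1 : ∫ x in Ω, v x ≤ ∫ x in Ω, (g x + (1 + π / 2)) := by
    refine setIntegral_mono_on hvi (hgi.integrableOn.add (integrableOn_const hvol))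
      hΩ.measurableSet fun x hx => ?_
    simp only [hg, hx, if_true]
    exact Phi_ge _
  rw [integral_add hgi.integrableOn (integrableOn_const hvol), setIntegral_const, smul_eq_mul] at h1
  have h2 : ∫ x in Ω, g x ≤ ∫ x, g x := by
    refine setIntegral_le_integral hgi (Eventually.of_forall fun x => ?_)
    simp only [hg]
    change 0 ≤ if x ∈ Ω then Phi (v x) else 0
    split_ifs
    · exact Phi_nonneg _
    · exact le_rfl
  linarith

section Final

variable {m : ℕ} (S : Setting m)

/-- the density -/
def rho (k : ℕ) (x : E2) : ℝ := S.lam k * S.V x * Real.exp (S.v k x)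

lemma closure_compact : IsCompact (closure S.Ω) := S.hbd.isCompact_closure

lemma V_bounds : ∃ a b : ℝ, 0 < a ∧ ∀ x ∈ closure S.Ω, a ≤ S.V x ∧ S.V x ≤ b := by
  have hne : (closure S.Ω).Nonempty := ⟨_, subset_closure (S.hx_mem ⟨0, S.hm⟩)⟩
  obtain ⟨x, hx, hx'⟩ := (closure_compact S).exists_isMinOn hne S.hVreg.continuousOn
  obtain ⟨y, hy, hy'⟩ := (closure_compact S).exists_isMaxOn hne S.hVreg.continuousOn
  exact ⟨S.V x, S.V y, S.hVpos x hx, fun z hz => ⟨hx' hz, hy' hz⟩⟩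

lemma rho_pos (k : ℕ) {x : E2} (hx : x ∈ closure S.Ω) : 0 < rho S k x :=
  mul_pos (mul_pos (S.hlam_pos k) (S.hVpos x hx)) (Real.exp_pos _)

lemma rho_cont (k : ℕ) : ContinuousOn (rho S k) (closure S.Ω) :=
  (continuousOn_const.mul S.hVreg.continuousOn).mul (Real.continuous_exp.comp_continuousOn (S.hv_cont k))

lemma rho_int (k : ℕ) : IntegrableOn (rho S k) S.Ω :=
  ((rho_cont S k).integrableOn_compact (closure_compact S)).mono_set subset_closure

lemma v_nonneg (k : ℕ) : ∀ x ∈ closure S.Ω, 0 ≤ S.v k x := by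
  refine max_principle S.hopen S.hbd (S.hv_reg k) (S.hv_cont k) (fun x hx => ?_)
    fun x hx => (S.hBC k x hx).ge
  have h := S.hPDE k x hx
  have h2 := rho_pos S k (subset_closure hx)
  unfold rho at h2
  linarith

lemma mu_pos (W : EigenData S) (k n : ℕ) (hn : 1 ≤ n) : 0 < W.mu n k := by
  induction n, hn using Nat.le_induction with
  | base => exact W.hpos k
  | succ n hn ih =>
    rcases Nat.lt_or_ge n 2 with h | h
    · have : n = 1 := by omega
      subst this
      exact ih.trans (W.hlt k)
    · exact ih.trans_le (W.hmono k n h)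

lemma w_le (W : EigenData S) (k n : ℕ) (hn : 1 ≤ n) :
    ∀ x ∈ closure S.Ω, |W.w n k x| ≤ W.mu n k * S.v k x := by
  have hmu := mu_pos S W k n hn
  have key : ∀ s : ℝ, |s| ≤ 1 → ∀ x ∈ closure S.Ω, 0 ≤ W.mu n k * S.v k x + s * W.w n k x := by
    intro s hs
    refine max_principle S.hopen S.hbd
      ((contDiffOn_const.mul (S.hv_reg k)).add (contDiffOn_const.mul (W.hw_reg n k)))
      ((continuousOn_const.mul (S.hv_cont k)).add (continuousOn_const.mul (W.hw_cont n k)))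
      (fun x hx => ?_) fun x hx => by simp [S.hBC k x hx, W.hBC n k x hx]
    have hn := S.hopen.mem_nhds hx
    rw [lap_lin ((S.hv_reg k).contDiffAt hn) ((W.hw_reg n k).contDiffAt hn)]
    have h1 := S.hPDE k x hx
    have h2 := W.hPDE n k x hx
    have h3 := rho_pos S k (subset_closure hx)
    have h4 := W.hbound n k x (subset_closure hx)
    have h5 : |s * W.w n k x| ≤ 1 := by
      rw [abs_mul]; exact mul_le_one₀ hs (abs_nonneg _) h4
    have e1 : lap (S.v k) x = - rho S k x := by unfold rho; linarith
    have e2 : lap (W.w n k) x = - (W.mu n k * rho S k x * W.w n k x) := by unfold rho; linarith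
    rw [e1, e2]
    have h6 := neg_le_of_abs_le h5
    have h7 : 0 ≤ W.mu n k * rho S k x := by positivity
    nlinarith
  intro x hx
  have h1 := key 1 (by simp) x hx
  have h2 := key (-1) (by simp) x hx
  rw [abs_le]; constructor <;> linarith

lemma mass_bound : ∃ M : ℝ, 0 ≤ M ∧ ∀ k, ∫ x in S.Ω, rho S k x ≤ M := by
  obtain ⟨M, hM⟩ := S.hmass.bddAbove_range
  refine ⟨max M 0, le_max_right _ _, fun k => le_trans (hM ⟨k, rfl⟩) (le_max_left _ _)⟩

lemma v_L1 : ∃ C : ℝ, 0 ≤ C ∧ ∀ k, ∫ x in S.Ω, S.v k x ≤ C := by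
  obtain ⟨M, hM0, hM⟩ := mass_bound S
  obtain ⟨D, hD⟩ := (closure_compact S).isBounded.exists_norm_le
  refine ⟨D ^ 2 / 4 * M + (1 + π / 2) * volume.real S.Ω, by positivity, fun k => ?_⟩
  have h := L1_bound S.hopen S.hbd hD (S.hv_reg k) (S.hv_cont k) (S.hBC k) (ρ := rho S k)
    (S.hPDE k) (fun x hx => (rho_pos S k (subset_closure hx)).le) (rho_int S k)
  have h2 : D ^ 2 / 4 * ∫ x in S.Ω, rho S k x ≤ D ^ 2 / 4 * M :=
    mul_le_mul_of_nonneg_left (hM k) (by positivity)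
  linarith

lemma bsub (j : Fin m) (k : ℕ) : closedBall (S.xpt j k) S.R ⊆ S.Ω := by
  refine subset_trans (closedBall_subset_closedBall' ?_) (S.hR2 j)
  have := S.hxpt_mem j k
  rw [mem_ball] at this
  linarith

lemma xpt_mem (j : Fin m) (k : ℕ) : S.xpt j k ∈ S.Ω :=
  bsub S j k (mem_closedBall_self S.hR.le)

lemma delta_pos (j : Fin m) (k : ℕ) : 0 < S.delta j k :=
  inv_pos.2 (Real.sqrt_pos.2 (rho_pos S k (subset_closure (xpt_mem S j k))))

lemma delta_sq (j : Fin m) (k : ℕ) : S.delta j k ^ 2 * rho S k (S.xpt j k) = 1 := by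
  have h := rho_pos S k (subset_closure (xpt_mem S j k))
  unfold Setting.delta
  rw [inv_pow]
  change (√(rho S k (S.xpt j k)) ^ 2)⁻¹ * _ = 1
  rw [Real.sq_sqrt h.le, inv_mul_cancel₀ h.ne']

lemma pt_mem (j : Fin m) (k : ℕ) {y : E2} {r : ℝ} (h : ‖S.delta j k • y‖ < r) :
    S.xpt j k + S.delta j k • y ∈ ball (S.xpt j k) r := by
  rw [mem_ball, dist_eq_norm]; simpa using h

/-- the rescaled density, cut off -/
def FF (j : Fin m) (k : ℕ) (y : E2) : ℝ :=
  S.delta j k ^ 2 * (ball (S.xpt j k) S.R).indicator (rho S k) (S.xpt j k + S.delta j k • y)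

lemma FF_eq (j : Fin m) (k : ℕ) {y : E2} (h : ‖S.delta j k • y‖ < S.R) :
    FF S j k y = S.delta j k ^ 2 * rho S k (S.xpt j k + S.delta j k • y) := by
  unfold FF
  rw [Set.indicator_of_mem (pt_mem S j k h)]

lemma FF_nonneg (j : Fin m) (k : ℕ) (y : E2) : 0 ≤ FF S j k y := by
  unfold FF
  refine mul_nonneg (sq_nonneg _) (Set.indicator_nonneg (fun x hx => ?_) _)
  exact (rho_pos S k (subset_closure (bsub S j k (ball_subset_closedBall hx)))).le

lemma FF_int (j : Fin m) (k : ℕ) : Integrable (FF S j k) := by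
  have h1 : Integrable ((ball (S.xpt j k) S.R).indicator (rho S k)) :=
    ((rho_int S k).mono_set (ball_subset_closedBall.trans (bsub S j k))).integrable_indicator
      measurableSet_ball
  exact ((h1.comp_add_left (S.xpt j k)).comp_smul (delta_pos S j k).ne').const_mul _

lemma FF_mass (j : Fin m) (k : ℕ) : ∫ y, |FF S j k y| ≤ ∫ x in S.Ω, rho S k x := by
  have hd := delta_pos S j k
  have e : ∫ y, |FF S j k y| = ∫ x in ball (S.xpt j k) S.R, rho S k x := by
    simp_rw [abs_of_nonneg (FF_nonneg S j k _)]
    unfold FF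
    rw [integral_const_mul, Measure.integral_comp_smul volume
      (fun y => (ball (S.xpt j k) S.R).indicator (rho S k) (S.xpt j k + y)),
      integral_add_left_eq_self, integral_indicator measurableSet_ball]
    rw [finrank_euclideanSpace, Fintype.card_fin, abs_of_pos (by positivity), smul_eq_mul,
      ← mul_assoc, mul_inv_cancel₀ (by positivity), one_mul]
  rw [e]
  refine setIntegral_mono_set (rho_int S k) ?_
    (LE.le.eventuallyLE (ball_subset_closedBall.trans (bsub S j k)))
  filter_upwards [ae_restrict_mem S.hopen.measurableSet] with x hx
  exact (rho_pos S k (subset_closure hx)).le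

lemma FF_fac (j : Fin m) (k : ℕ) {y : E2} (h : ‖S.delta j k • y‖ < S.R) :
    FF S j k y = S.V (S.xpt j k + S.delta j k • y) / S.V (S.xpt j k) *
      Real.exp (S.v k (S.xpt j k + S.delta j k • y) - S.v k (S.xpt j k)) := by
  have h1 := delta_sq S j k
  have hV := S.hVpos _ (subset_closure (xpt_mem S j k))
  have hl := S.hlam_pos k
  have hE := Real.exp_pos (S.v k (S.xpt j k))
  rw [FF_eq S j k h, Real.exp_sub]
  unfold rho at *
  rw [div_mul_div_comm, eq_div_iff (by positivity)]
  calc _ = (S.delta j k ^ 2 * (S.lam k * S.V (S.xpt j k) * Real.exp (S.v k (S.xpt j k)))) *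
        (S.V (S.xpt j k + S.delta j k • y) * Real.exp (S.v k (S.xpt j k + S.delta j k • y))) := by ring
    _ = _ := by rw [h1, one_mul]

lemma FF_bound : ∃ B : ℝ, 1 ≤ B ∧ ∀ j k y, |FF S j k y| ≤ B := by
  obtain ⟨a, b, ha, hab⟩ := V_bounds S
  refine ⟨max 1 (b / a), le_max_left _ _, fun j k y => ?_⟩
  rw [abs_of_nonneg (FF_nonneg S j k y)]
  by_cases h : ‖S.delta j k • y‖ < S.R
  · rw [FF_fac S j k h]
    have hp := pt_mem S j k h
    have hmem := subset_closure (bsub S j k (ball_subset_closedBall hp))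
    have h1 := S.hxpt_max j k _ hp
    have h2 := hab _ hmem
    have h3 := hab _ (subset_closure (xpt_mem S j k))
    refine le_trans ?_ (le_max_right _ _)
    have h4 : Real.exp (S.v k (S.xpt j k + S.delta j k • y) - S.v k (S.xpt j k)) ≤ 1 :=
      Real.exp_le_one_iff.2 (by linarith)
    have h5 : S.V (S.xpt j k + S.delta j k • y) / S.V (S.xpt j k) ≤ b / a :=
      div_le_div₀ (by linarith) h2.2 ha h3.1
    have h6 : 0 ≤ S.V (S.xpt j k + S.delta j k • y) / S.V (S.xpt j k) :=
      div_nonneg (by linarith) (by linarith)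
    calc _ ≤ S.V (S.xpt j k + S.delta j k • y) / S.V (S.xpt j k) * 1 :=
        mul_le_mul_of_nonneg_left h4 h6
      _ ≤ _ := by rw [mul_one]; exact h5
  · have : FF S j k y = 0 := by
      unfold FF
      rw [Set.indicator_of_notMem, mul_zero]
      rw [mem_ball, dist_eq_norm]; simpa using h
    rw [this]; positivity

lemma mkResc (j : Fin m) (u : ℕ → E2 → ℝ) (hu : ∀ k, ContDiffOn ℝ 2 (u k) S.Ω) (G : ℕ → E2 → ℝ)
    (hG : ∀ k y, ‖S.delta j k • y‖ < S.R →
      G k y = -(S.delta j k ^ 2 * lap (u k) (S.xpt j k + S.delta j k • y)))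
    (B C C1 : ℝ) (hi : ∀ k, Integrable (G k)) (hB : ∀ k y, |G k y| ≤ B)
    (hC : ∀ k, ∫ y, |G k y| ≤ C) (h1 : ∀ k, ∫ y in ball (S.xpt j k) S.R, |u k y| ≤ C1) :
    ∃ A, 0 ≤ A ∧ Resc S.R S.hR (S.delta j)
      (fun k x => u k (S.xpt j k + S.delta j k • x) - u k (S.xpt j k))
      (fun k x => (S.delta j k : ℂ) * Dc (u k) (S.xpt j k + S.delta j k • x)) G A B C := by
  obtain ⟨c, hc, H⟩ := rep_scaled S.R S.hR
  have hC1 : 0 ≤ C1 := le_trans (integral_nonneg fun _ => abs_nonneg _) (h1 0)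
  refine ⟨c * C1, by positivity, ?_, ?_, ?_, hi, hB, hC⟩
  · intro k; simp
  · intro k x hx
    have hx' : ‖S.delta j k • x‖ < S.R := by have := S.hR; linarith
    have hmem : S.xpt j k + S.delta j k • x ∈ S.Ω :=
      bsub S j k (ball_subset_closedBall (pt_mem S j k hx'))
    have hd := (((hu k).contDiffAt (S.hopen.mem_nhds hmem)).differentiableAt (by simp)).hasFDerivAt
    have hin : HasFDerivAt (fun x : E2 => S.xpt j k + S.delta j k • x)
        (S.delta j k • ContinuousLinearMap.id ℝ E2) x :=
      ((hasFDerivAt_id x).const_smul (S.delta j k)).const_add _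
    have h2 := (hd.comp x hin).sub_const (u k (S.xpt j k))
    refine h2.congr_fderiv ?_
    rw [← Lm_Dc]
    ext y
    simp only [ContinuousLinearMap.comp_apply, _root_.smul_apply, ContinuousLinearMap.id_apply, map_smul]
    rw [← Complex.real_smul, map_smul]
    simp
  · intro k x hx
    refine (H S.Ω S.hopen (u k) (hu k) (S.xpt j k) (bsub S j k) _ (delta_pos S j k) (G k)
      (hG k) x hx).trans ?_
    calc _ ≤ c * S.delta j k * C1 :=
          mul_le_mul_of_nonneg_left (h1 k) (mul_nonneg hc (delta_pos S j k).le)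
      _ = _ := by ring

end Final

section Final2

variable {m : ℕ} (S : Setting m)

lemma v_int (k : ℕ) : IntegrableOn (S.v k) S.Ω :=
  ((S.hv_cont k).integrableOn_compact (closure_compact S)).mono_set subset_closure

lemma v_ball (k : ℕ) {s : Set E2} (hs : s ⊆ S.Ω) :
    ∫ x in s, S.v k x ≤ ∫ x in S.Ω, S.v k x := by
  refine setIntegral_mono_set (v_int S k) ?_ (LE.le.eventuallyLE hs)
  filter_upwards [ae_restrict_mem S.hopen.measurableSet] with x hx
  exact v_nonneg S k x (subset_closure hx)

lemma fResc (j : Fin m) {B M C1 : ℝ} (hB : ∀ j k y, |FF S j k y| ≤ B)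
    (hM : ∀ k, ∫ x in S.Ω, rho S k x ≤ M) (hC1 : ∀ k, ∫ x in S.Ω, S.v k x ≤ C1) :
    ∃ A, 0 ≤ A ∧ Resc S.R S.hR (S.delta j)
      (fun k x => S.v k (S.xpt j k + S.delta j k • x) - S.v k (S.xpt j k))
      (fun k x => (S.delta j k : ℂ) * Dc (S.v k) (S.xpt j k + S.delta j k • x)) (FF S j) A B M := by
  refine mkResc S j S.v S.hv_reg (FF S j) (fun k y hy => ?_) B M C1 (FF_int S j) (hB j)
    (fun k => (FF_mass S j k).trans (hM k)) fun k => ?_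
  · rw [FF_eq S j k hy]
    have := S.hPDE k _ (bsub S j k (ball_subset_closedBall (pt_mem S j k hy)))
    rw [← mul_neg, this]; rfl
  · have hsub := ball_subset_closedBall.trans (bsub S j k)
    refine le_trans (le_of_eq ?_) ((v_ball S k hsub).trans (hC1 k))
    refine setIntegral_congr_fun measurableSet_ball fun x hx => ?_
    exact abs_of_nonneg (v_nonneg S k x (subset_closure (hsub hx)))

lemma delta_tendsto (j : Fin m) : Tendsto (S.delta j) atTop (𝓝 0) := by
  obtain ⟨B, hB1, hB⟩ := FF_bound S
  obtain ⟨M, hM0, hM⟩ := mass_bound S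
  obtain ⟨C1, hC0, hC1⟩ := v_L1 S
  obtain ⟨A, hA, H⟩ := fResc S j hB hM hC1
  have hR := S.hR
  have hk := kap_pos
  have hKK : 0 ≤ KK 1 := KK_nonneg 1
  set D := KK 1 * B + M + 1 with hD
  have hDpos : 0 < D := by positivity
  set ω := volume.real (ball (0 : E2) (S.R / 4)) with hω
  have hωpos : 0 < ω := by
    rw [hω, Measure.real, ENNReal.toReal_pos_iff]
    exact ⟨measure_ball_pos _ _ (by positivity), measure_ball_lt_top⟩
  have main : ∀ k, ((S.v k (S.xpt j k) - C1 / ω) * (kap * 4 / S.R) - A) / D ≤ (S.delta j k)⁻¹ := by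
    intro k
    have hd := delta_pos S j k
    set p := S.xpt j k
    set δ := S.delta j k with hδ
    set s : Set E2 := {x | ‖δ • x‖ < S.R / 4} with hs
    have hconv : Convex ℝ s := by
      have : s = (δ • (LinearMap.id : E2 →ₗ[ℝ] E2)) ⁻¹' ball 0 (S.R / 4) := by
        ext x; simp [hs]
      rw [this]
      exact (convex_ball _ _).linear_preimage _
    have hPb : ∀ x ∈ s, ‖Lm ((δ : ℂ) * Dc (S.v k) (p + δ • x))‖ ≤ (A * δ + D) / kap := by
      intro x hx
      refine (Lm_norm_le _).trans ?_
      have h1 := H.hP k x hx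
      have h2 := kern_le (F := fun y => ((bump S.R S.hR (δ • (y - x)) * FF S j k y : ℝ) : ℂ))
        (bump_mul_integrable S.hR δ (H.hi k) x).ofReal (B := B) (fun y => by
          rw [Complex.norm_real]; exact (bump_mul_le S.hR _ _).trans (H.hB k y)) x
      have h3 : ∫ y, ‖((bump S.R S.hR (δ • (y - x)) * FF S j k y : ℝ) : ℂ)‖ ≤ M := by
        refine le_trans (integral_mono ?_ ((H.hi k).abs) fun y => ?_) (H.hC k)
        · exact (bump_mul_integrable S.hR δ (H.hi k) x).ofReal.norm
        · simp only [Complex.norm_real]; exact bump_mul_le S.hR _ _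
      rw [le_div_iff₀ hk]
      have h4 := norm_le_norm_sub_add ((kap : ℂ) * ((δ : ℂ) * Dc (S.v k) (p + δ • x)))
        (∫ y, kc (y - x) * ((bump S.R S.hR (δ • (y - x)) * FF S j k y : ℝ) : ℂ))
      rw [norm_mul (kap : ℂ), Complex.norm_real, Real.norm_of_nonneg hk.le] at h4
      have h5 := h1.trans (le_refl (A * δ))
      nlinarith
    have hlow : ∀ y ∈ ball p (S.R / 4),
        S.v k p - (A * δ + D) / kap * (S.R / 4 / δ) ≤ S.v k y := by
      intro y hy
      have hy' : ‖y - p‖ < S.R / 4 := by rwa [mem_ball, dist_eq_norm] at hy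
      have e1 : δ • (δ⁻¹ • (y - p)) = y - p := smul_inv_smul₀ hd.ne' _
      have hm1 : δ⁻¹ • (y - p) ∈ s := by simp only [hs, Set.mem_setOf_eq, e1]; exact hy'
      have hm0 : (0 : E2) ∈ s := by simp [hs, hR]
      have h := hconv.norm_image_sub_le_of_norm_hasFDerivWithin_le
        (fun x hx => (H.hd k x hx).hasFDerivWithinAt) hPb hm0 hm1
      simp only [smul_zero, add_zero, sub_self, sub_zero] at h
      change ‖S.v k (p + δ • δ⁻¹ • (y - p)) - S.v k p‖ ≤ _ at h
      rw [e1, add_sub_cancel, norm_smul, norm_inv, Real.norm_of_nonneg hd.le] at h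
      have h2 : δ⁻¹ * ‖y - p‖ ≤ S.R / 4 / δ := by
        rw [div_eq_inv_mul]; exact mul_le_mul_of_nonneg_left hy'.le (by positivity)
      have h3 : (A * δ + D) / kap * (δ⁻¹ * ‖y - p‖) ≤ (A * δ + D) / kap * (S.R / 4 / δ) :=
        mul_le_mul_of_nonneg_left h2 (by positivity)
      have h4 := neg_le_of_abs_le (h.trans h3)
      linarith
    have hsub : ball p (S.R / 4) ⊆ S.Ω :=
      (ball_subset_closedBall.trans (closedBall_subset_closedBall (by linarith))).trans (bsub S j k)
    have hIntg : ω * (S.v k p - (A * δ + D) / kap * (S.R / 4 / δ)) ≤ C1 := by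
      refine le_trans ?_ ((v_ball S k hsub).trans (hC1 k))
      have h1 : ∫ x in ball p (S.R / 4), (S.v k p - (A * δ + D) / kap * (S.R / 4 / δ))
          ≤ ∫ x in ball p (S.R / 4), S.v k x :=
        setIntegral_mono_on (integrableOn_const measure_ball_lt_top.ne)
          ((v_int S k).mono_set hsub) measurableSet_ball hlow
      rw [setIntegral_const, smul_eq_mul] at h1
      have e : volume.real (ball p (S.R / 4)) = ω := by
        rw [hω, Measure.real, Measure.real, Measure.addHaar_ball_center]
      rwa [e] at h1
    have h1 : S.v k p - C1 / ω ≤ (A * δ + D) / kap * (S.R / 4 / δ) := by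
      rw [mul_comm, ← le_div_iff₀ hωpos] at hIntg
      linarith
    have e : (A * δ + D) / kap * (S.R / 4 / δ) * (kap * 4 / S.R) = A + D * δ⁻¹ := by
      field_simp
    have h2 := mul_le_mul_of_nonneg_right h1 (show 0 ≤ kap * 4 / S.R by positivity)
    rw [e] at h2
    rw [div_le_iff₀ hDpos]
    linarith
  have ht : Tendsto (fun k => ((S.v k (S.xpt j k) - C1 / ω) * (kap * 4 / S.R) - A) / D)
      atTop atTop := by
    refine Tendsto.atTop_div_const hDpos ?_
    refine tendsto_atTop_add_const_right _ (-A) ?_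
    refine Tendsto.atTop_mul_const (by positivity) ?_
    exact tendsto_atTop_add_const_right _ (-(C1 / ω)) (S.hxpt_blow j)
  have h := (tendsto_atTop_mono main ht).inv_tendsto_atTop
  simpa [Pi.inv_def] using h

lemma Resc.comp {R : ℝ} {hR : 0 < R} {δ : ℕ → ℝ} {f : ℕ → E2 → ℝ} {P : ℕ → E2 → ℂ}
    {F : ℕ → E2 → ℝ} {A B C : ℝ} (H : Resc R hR δ f P F A B C) (φ : ℕ → ℕ) :
    Resc R hR (fun k => δ (φ k)) (fun k => f (φ k)) (fun k => P (φ k)) (fun k => F (φ k)) A B C :=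
  ⟨fun k => H.f0 _, fun k => H.hd _, fun k => H.hP _, fun k => H.hi _, fun k => H.hB _,
    fun k => H.hC _⟩

lemma a_lim (j : Fin m) (L η : ℝ) (hη : 0 < η) : ∀ᶠ k in atTop, ∀ y ∈ ball (0 : E2) L,
    |S.V (S.xpt j k + S.delta j k • y) / S.V (S.xpt j k) - 1| ≤ η := by
  have hx := S.hx_mem j
  have hV := S.hVpos _ (subset_closure hx)
  set x0 := S.xstar j
  have hcont : ContinuousAt S.V x0 :=
    (S.hVreg.continuousOn.mono subset_closure).continuousAt (S.hopen.mem_nhds hx)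
  have hq : ContinuousAt (fun q : E2 × E2 => S.V q.1 / S.V q.2) (x0, x0) := by
    refine ContinuousAt.div ?_ ?_ hV.ne'
    · exact ContinuousAt.comp (f := Prod.fst) (x := (x0, x0)) hcont continuousAt_fst
    · exact ContinuousAt.comp (f := Prod.snd) (x := (x0, x0)) hcont continuousAt_snd
  have h1 := Metric.continuousAt_iff.1 hq η hη
  obtain ⟨d, hd, h⟩ := h1
  have e1 := (Metric.tendsto_nhds.1 (S.hxpt_lim j)) (d / 2) (by positivity)
  have e2 := small_ev (delta_tendsto S j) (R := 2 * d) (by positivity) L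
  filter_upwards [e1, e2] with k h1 h2 y hy
  have h3 := h2 y hy
  have h4 : dist (S.xpt j k + S.delta j k • y) x0 < d := by
    have := dist_triangle (S.xpt j k + S.delta j k • y) (S.xpt j k) x0
    have e : dist (S.xpt j k + S.delta j k • y) (S.xpt j k) = ‖S.delta j k • y‖ := by
      rw [dist_eq_norm]; simp
    linarith
  have h5 := @h (S.xpt j k + S.delta j k • y, S.xpt j k) (by
    rw [Prod.dist_eq]; exact max_lt h4 (by linarith))
  rw [Real.dist_eq] at h5
  simp only [div_self hV.ne'] at h5
  exact h5.le

lemma final_local (W : EigenData S) (φ : ℕ → ℕ) (hφ : StrictMono φ) (n : ℕ) (hn : 1 ≤ n)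
    (j : Fin m) (c : ℝ)
    (hc : TendstoLocallyUniformly
      (fun k (x : E2) => W.w n (φ k) (S.delta j (φ k) • x + S.xpt j (φ k))) (fun _ => c) atTop)
    (r ε : ℝ) (hr : 0 < r) (hε : 0 < ε) : ∀ᶠ k in atTop, ∀ x ∈ ball (0 : E2) r,
      |((W.mu n (φ k))⁻¹ * W.w n (φ k) (S.xpt j (φ k) + S.delta j (φ k) • x)
        - (W.mu n (φ k))⁻¹ * W.w n (φ k) (S.xpt j (φ k))) - c * U x| ≤ ε := by
  obtain ⟨B, hB1, hB⟩ := FF_bound S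
  obtain ⟨M, hM0, hM⟩ := mass_bound S
  obtain ⟨C1, hC0, hC1⟩ := v_L1 S
  obtain ⟨A, hA, H⟩ := fResc S j hB hM hC1
  have hR := S.hR
  have hφt := hφ.tendsto_atTop
  have hδ := delta_tendsto S j
  -- the cut off eigenfunction
  let ww : ℕ → E2 → ℝ := fun k y =>
    (ball (S.xpt j k) S.R).indicator (W.w n k) (S.xpt j k + S.delta j k • y)
  have hww : ∀ k y, ‖S.delta j k • y‖ < S.R → ww k y = W.w n k (S.xpt j k + S.delta j k • y) :=
    fun k y hy => Set.indicator_of_mem (pt_mem S j k hy) _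
  have hww1 : ∀ k y, |ww k y| ≤ 1 := by
    intro k y
    by_cases h : S.xpt j k + S.delta j k • y ∈ ball (S.xpt j k) S.R
    · simp only [ww, Set.indicator_of_mem h]
      exact W.hbound n k _ (subset_closure (bsub S j k (ball_subset_closedBall h)))
    · simp [ww, Set.indicator_of_notMem h]
  have hwm : ∀ k, Integrable (fun y => FF S j k y * ww k y) := by
    intro k
    refine (FF_int S j k).mul_bdd (c := 1) ?_ (Eventually.of_forall fun y => hww1 k y)
    have h1 : Integrable ((ball (S.xpt j k) S.R).indicator (W.w n k)) := by
      refine IntegrableOn.integrable_indicator ?_ measurableSet_ball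
      exact ((W.hw_cont n k).integrableOn_compact (closure_compact S)).mono_set
        ((ball_subset_closedBall.trans (bsub S j k)).trans subset_closure)
    exact ((h1.comp_add_left (S.xpt j k)).comp_smul (delta_pos S j k).ne').aestronglyMeasurable
  have hle : ∀ k y, |FF S j k y * ww k y| ≤ |FF S j k y| := by
    intro k y
    rw [abs_mul]
    exact mul_le_of_le_one_right (abs_nonneg _) (hww1 k y)
  obtain ⟨A', hA', H'⟩ := mkResc S j (fun k x => (W.mu n k)⁻¹ * W.w n k x)
    (fun k => contDiffOn_const.mul (W.hw_reg n k)) (fun k y => FF S j k y * ww k y)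
    (fun k y hy => by
      have hmem := bsub S j k (ball_subset_closedBall (pt_mem S j k hy))
      have hmu := mu_pos S W k n hn
      have hw := (W.hw_reg n k).contDiffAt (S.hopen.mem_nhds hmem)
      have hl := lap_lin hw hw (W.mu n k)⁻¹ 0
      simp only [zero_mul, add_zero] at hl
      have hp := W.hPDE n k _ hmem
      rw [hl, hww k y hy, FF_eq S j k hy]
      have e : lap (W.w n k) (S.xpt j k + S.delta j k • y) = -(W.mu n k *
        (rho S k (S.xpt j k + S.delta j k • y) * W.w n k (S.xpt j k + S.delta j k • y))) := by
        unfold rho; linarith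
      rw [e]
      field_simp)
    B M C1 hwm (fun k y => (hle k y).trans (hB j k y))
    (fun k => (integral_mono (hwm k).abs (FF_int S j k).abs (hle k)).trans
      ((FF_mass S j k).trans (hM k)))
    (fun k => by
      have hsub := ball_subset_closedBall.trans (bsub S j k)
      have hmu := mu_pos S W k n hn
      refine le_trans ?_ ((v_ball S k hsub).trans (hC1 k))
      refine setIntegral_mono_on ?_ ((v_int S k).mono_set hsub) measurableSet_ball fun x hx => ?_
      · refine (((W.hw_cont n k).integrableOn_compact (closure_compact S)).mono_set
          (hsub.trans subset_closure)).const_mul _ |>.abs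
      · rw [abs_mul, abs_of_pos (inv_pos.2 hmu), inv_mul_le_iff₀ hmu]
        exact w_le S W k n hn x (subset_closure (hsub hx)))
  refine local_main (H.comp φ) hB1 (hδ.comp hφt)
    (a := fun k y => S.V (S.xpt j (φ k) + S.delta j (φ k) • y) / S.V (S.xpt j (φ k)))
    (fun k x hx => ?_) (fun k x hx => ?_) (fun L η hη => ?_) (H'.comp φ)
    (W := fun k => ww (φ k)) (fun k y => hww1 _ y) (fun L η hη => ?_) r ε hr hε
  · have := S.hxpt_max j (φ k) _ (pt_mem S j (φ k) (r := S.R) (by linarith))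
    linarith
  · exact FF_fac S j (φ k) (by linarith)
  · exact hφt.eventually (a_lim S j L η hη)
  · have h1 := tendstoLocallyUniformly_iff_forall_isCompact.1 hc _ (isCompact_closedBall (0 : E2) L)
    have h2 := Metric.tendstoUniformlyOn_iff.1 h1 η hη
    have h3 := hφt.eventually (small_ev hδ hR L)
    filter_upwards [h2, h3] with k h2 h3 y hy
    have h4 := h3 y hy
    rw [hww (φ k) y (by linarith), add_comm]
    have h5 := h2 y (ball_subset_closedBall hy)
    rw [dist_comm, Real.dist_eq] at h5
    exact h5.le

end Final2

/-- for a further subsequence,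
`w̃ⁿ_{j,k}(x) = wⁿ_k(x_{j,k}) + μⁿ_k cⁿ_j U(x) + o(μⁿ_k)` locally uniformly in `ℝ²`. -/
theorem statement5 {m : ℕ} (S : Setting m) (W : EigenData S)
    (φ : ℕ → ℕ) (hφ : StrictMono φ) (c : ℕ → Fin m → ℝ)
    (hc : ∀ n, 1 ≤ n → n ≤ m → IsLimitVec S W φ n (c n)) :
    ∀ n, 1 ≤ n → n ≤ m → ∃ ψ : ℕ → ℕ, StrictMono ψ ∧
      ∀ j : Fin m, TendstoLocallyUniformly
        (fun k (x : E2) =>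
          (W.w n (φ (ψ k)) (S.delta j (φ (ψ k)) • x + S.xpt j (φ (ψ k)))
            - W.w n (φ (ψ k)) (S.xpt j (φ (ψ k)))
            - W.mu n (φ (ψ k)) * c n j * U x) / W.mu n (φ (ψ k)))
        (fun _ => (0 : ℝ)) atTop := by
  intro n hn hnm
  refine ⟨id, strictMono_id, fun j => ?_⟩
  simp only [id]
  rw [tendstoLocallyUniformly_iff_forall_isCompact]
  intro K hK
  rw [Metric.tendstoUniformlyOn_iff]
  intro ε hε
  obtain ⟨r, hr⟩ := hK.isBounded.subset_ball (0 : E2)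
  filter_upwards [final_local S W φ hφ n hn j (c n j) ((hc n hn hnm).2 j) (max r 1) (ε / 2)
    (by positivity) (by positivity)] with k hk x hx
  have h1 := hk x (ball_subset_ball (le_max_left _ _) (hr hx))
  have hmu := mu_pos S W (φ k) n hn
  rw [dist_comm, Real.dist_eq, sub_zero]
  refine lt_of_le_of_lt (le_of_eq_of_le ?_ h1) (by linarith)
  congr 1
  rw [add_comm (S.xpt j (φ k))]
  field_simp
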